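/- Let G=SO⁺_Q(ℝ)≤GL_n(ℝ) for an indefinite nondegenerate quadratic form Q, let K≤G be a maximal compact subgroup and A≤G a Cartan subgroup (a maximal connected subgroup consisting of matrices diagonalizable over ℝ with positive eigenvalues, satisfying ‖a^s‖=‖a‖^s for a in a positive chamber and s∈[0,1]) with G=KAK, and set C=sup{‖k‖ : k∈K}. Then there is a constant c>0 such that m_G(γG_t∩G_t)≥c uniformly for all t>2C² and all γ∈G with ‖γ‖≤t²/(4C⁴); in fact m_G(γG_t∩G_t)≥m_G(G₂)>0. -/

import Mathlib

open MeasureTheory Matrix Filter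
open scoped ENNReal Real

noncomputable section

instance {n : ℕ} : MeasurableSpace (Matrix (Fin n) (Fin n) ℝ) :=
  inferInstanceAs (MeasurableSpace (Fin n → Fin n → ℝ))

/-- The Euclidean norm of a vector in `ℝⁿ`. -/
def eunorm {n : ℕ} (v : Fin n → ℝ) : ℝ := Real.sqrt (∑ i, v i ^ 2)

/-- The operator norm of a matrix acting on Euclidean `ℝⁿ`. -/
def opNorm {n : ℕ} (g : Matrix (Fin n) (Fin n) ℝ) : ℝ :=
  ‖LinearMap.toContinuousLinearMap (Matrix.toEuclideanLin g)‖

/-- The norm `‖g‖ := ‖g⁻¹‖_op` used for norm balls. -/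
def mnorm {n : ℕ} (g : Matrix (Fin n) (Fin n) ℝ) : ℝ := opNorm g⁻¹

/-- `Q` is a nondegenerate quadratic form, represented by an invertible symmetric matrix. -/
def IsNondegQuadForm {n : ℕ} (Q : (Fin n → ℝ) → ℝ) : Prop :=
  ∃ J : Matrix (Fin n) (Fin n) ℝ, J.IsSymm ∧ IsUnit J.det ∧ ∀ v, Q v = v ⬝ᵥ J.mulVec v

/-- `Q` is proportional to a quadratic form with rational coefficients. -/
def IsRationalForm {n : ℕ} (Q : (Fin n → ℝ) → ℝ) : Prop :=
  ∃ c : ℝ, c ≠ 0 ∧ ∃ J : Matrix (Fin n) (Fin n) ℚ,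
    ∀ v, Q v = c * (v ⬝ᵥ (J.map (fun r => (r : ℝ))).mulVec v)

/-- `Q` has signature `(p,q)`: it is `GL_n(ℝ)`-equivalent to `v₁²+⋯+v_p²−v_{p+1}²−⋯−v_n²`. -/
def HasSignature {n : ℕ} (Q : (Fin n → ℝ) → ℝ) (p q : ℕ) : Prop :=
  p + q = n ∧ ∃ g : Matrix (Fin n) (Fin n) ℝ, IsUnit g.det ∧
    ∀ v, Q (vecMul v g) = ∑ i : Fin n, (if (i : ℕ) < p then (v i) ^ 2 else -((v i) ^ 2))

/-- The special orthogonal group of `Q` (acting on row vectors). -/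
def SOset {n : ℕ} (Q : (Fin n → ℝ) → ℝ) : Set (Matrix (Fin n) (Fin n) ℝ) :=
  {g | g.det = 1 ∧ ∀ v, Q (vecMul v g) = Q v}

/-- `SO⁺_Q(ℝ)`: the connected component of the identity in `SO_Q(ℝ)`. -/
def SOplus {n : ℕ} (Q : (Fin n → ℝ) → ℝ) : Set (Matrix (Fin n) (Fin n) ℝ) :=
  connectedComponentIn (SOset Q) 1

/-- `Γ = SO⁺_Q(ℤ) = SO⁺_Q(ℝ) ∩ SL_n(ℤ)`. -/
def SOZ {n : ℕ} (Q : (Fin n → ℝ) → ℝ) : Set (Matrix (Fin n) (Fin n) ℝ) :=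
  SOplus Q ∩ {g | ∀ i j, ∃ z : ℤ, g i j = (z : ℝ)}

/-- The norm ball `G_t = {g ∈ G : ‖g⁻¹‖_op ≤ t}` in `G = SO⁺_Q(ℝ)`. -/
def GballQ {n : ℕ} (Q : (Fin n → ℝ) → ℝ) (t : ℝ) : Set (Matrix (Fin n) (Fin n) ℝ) :=
  SOplus Q ∩ {g | mnorm g ≤ t}

/-- `μ` is a (left) Haar measure for the subgroup `G` of matrices: it is supported on `G`,
left-invariant under `G`, positive on open sets meeting `G` and finite on compact sets. -/
structure IsHaarOn {n : ℕ} (G : Set (Matrix (Fin n) (Fin n) ℝ))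
    (μ : Measure (Matrix (Fin n) (Fin n) ℝ)) : Prop where
  compl : μ Gᶜ = 0
  left_inv : ∀ g ∈ G, ∀ s : Set (Matrix (Fin n) (Fin n) ℝ),
    MeasurableSet s → μ ((g * ·) ⁻¹' s) = μ s
  open_pos : ∀ U : Set (Matrix (Fin n) (Fin n) ℝ), IsOpen U → (U ∩ G).Nonempty → 0 < μ U
  compact_fin : ∀ K : Set (Matrix (Fin n) (Fin n) ℝ), IsCompact K → μ K < ⊤

/-- Multiplication in `G̃ = G ⋉ ℝⁿ` (row-vector convention): `(h,α)(g,v) = (hg, αg+v)`. -/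
def tmul {n : ℕ} (x y : Matrix (Fin n) (Fin n) ℝ × (Fin n → ℝ)) :
    Matrix (Fin n) (Fin n) ℝ × (Fin n → ℝ) :=
  (x.1 * y.1, vecMul x.2 y.1 + y.2)

/-- The orbit relation of the right action of `Γ̃ = Γ ⋉ ℤⁿ` on `G̃`. -/
def latRel {n : ℕ} (Γ : Set (Matrix (Fin n) (Fin n) ℝ))
    (x y : Matrix (Fin n) (Fin n) ℝ × (Fin n → ℝ)) : Prop :=
  ∃ γ ∈ Γ, ∃ u : Fin n → ℤ, y = tmul x (γ, fun i => (u i : ℝ))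

/-- The quotient `G̃/Γ̃` (as a quotient of the ambient `Mat_n(ℝ) × ℝⁿ`). -/
def XQuot (n : ℕ) (Γ : Set (Matrix (Fin n) (Fin n) ℝ)) : Type :=
  Quot (latRel Γ)

instance (n : ℕ) (Γ : Set (Matrix (Fin n) (Fin n) ℝ)) : TopologicalSpace (XQuot n Γ) :=
  inferInstanceAs (TopologicalSpace (Quot _))

instance (n : ℕ) (Γ : Set (Matrix (Fin n) (Fin n) ℝ)) : MeasurableSpace (XQuot n Γ) := borel _

/-- The left action of `(g,w) ∈ G̃` on `G̃/Γ̃`. -/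
def actTG {n : ℕ} {Γ : Set (Matrix (Fin n) (Fin n) ℝ)} (g : Matrix (Fin n) (Fin n) ℝ)
    (w : Fin n → ℝ) : XQuot n Γ → XQuot n Γ :=
  Quot.map (fun x => (g * x.1, vecMul w x.1 + x.2)) (by
    rintro x y ⟨γ, hγ, u, rfl⟩
    refine ⟨γ, hγ, u, ?_⟩
    simp only [tmul, Prod.mk.injEq]
    constructor
    · rw [Matrix.mul_assoc]
    · rw [Matrix.add_vecMul, Matrix.vecMul_vecMul, add_assoc])

/-- The left action of `g ∈ G` on `G̃/Γ̃`. -/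
def actG {n : ℕ} {Γ : Set (Matrix (Fin n) (Fin n) ℝ)} (g : Matrix (Fin n) (Fin n) ℝ) :
    XQuot n Γ → XQuot n Γ := actTG g 0

/-- The averaging operator `β_S f (x) = (1/μ_G(S)) ∫_S f(g⁻¹x) dμ_G(g)`. -/
def avgOp {n : ℕ} {Γ : Set (Matrix (Fin n) (Fin n) ℝ)}
    (μG : Measure (Matrix (Fin n) (Fin n) ℝ)) (S : Set (Matrix (Fin n) (Fin n) ℝ))
    (f : XQuot n Γ → ℂ) (x : XQuot n Γ) : ℂ :=
  (μG S).toReal⁻¹ • ∫ g in S, f (actG g⁻¹ x) ∂μG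

/-- The unit cube `[0,1]ⁿ`, a fundamental domain for `ℝⁿ/ℤⁿ`. -/
def unitCube (n : ℕ) : Set (Fin n → ℝ) := Set.univ.pi fun _ => Set.Icc (0 : ℝ) 1

/-- Membership in `L²₀₀(G̃/Γ̃)`: the average of `f` over (almost) each fiber `ℝⁿ/ℤⁿ` vanishes. -/
def FiberAvgZero {n : ℕ} {Γ : Set (Matrix (Fin n) (Fin n) ℝ)}
    (μG : Measure (Matrix (Fin n) (Fin n) ℝ)) (f : XQuot n Γ → ℂ) : Prop :=
  ∀ᵐ g ∂μG, ∫ w in unitCube n, f (Quot.mk (latRel Γ) (g, w)) = 0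

/-- The exponent `κ₁` from Theorem 1.3 (property (T) cases). -/
def kappa1 (n : ℕ) : ℝ :=
  if n % 4 = 0 then 1 / n
  else if n % 4 = 1 then 1 / ((n : ℝ) - 1)
  else if n % 4 = 2 then 1 / ((n : ℝ) - 2)
  else 1 / ((n : ℝ) + 1)

/-- The exponent `κ₀` of Theorem 1.1, depending only on the signature `(p,q)`. -/
def kappa0 (p q : ℕ) : ℝ :=
  if q = 1 then 1
  else if (p, q) = (2, 2) then 2
  else if (p, q) = (4, 2) ∨ (p, q) = (3, 3) then 3 / 2
  else if (p, q) = (6, 3) then 5 / 2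
  else 2 * kappa1 (p + q) * q * ((p : ℝ) - 1)

section PosDiag

open Module

variable {V : Type*} [AddCommGroup V] [Module ℝ V]

/-- An endomorphism is positively diagonalizable if eigenvectors with positive eigenvalues span. -/
def PosDiag (f : End ℝ V) : Prop :=
  Submodule.span ℝ {v : V | ∃ μ : ℝ, 0 < μ ∧ f v = μ • v} = ⊤

lemma exists_basis_of_span_eq_top [FiniteDimensional ℝ V] {s : Set V}
    (hs : Submodule.span ℝ s = ⊤) : ∃ b : Basis (Fin (finrank ℝ V)) ℝ V, ∀ i, b i ∈ s := by
  let b := Basis.ofSpan hs.ge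
  have := FiniteDimensional.fintypeBasisIndex b
  have e := Fintype.equivFinOfCardEq (finrank_eq_card_basis b).symm
  refine ⟨b.reindex e, fun i => Basis.ofSpan_subset hs.ge ⟨e.symm i, ?_⟩⟩
  simp [b]

lemma PosDiag.exists_basis [FiniteDimensional ℝ V] {f : End ℝ V} (hf : PosDiag f) :
    ∃ (b : Basis (Fin (finrank ℝ V)) ℝ V) (d : Fin (finrank ℝ V) → ℝ),
      (∀ i, 0 < d i) ∧ ∀ i, f (b i) = d i • b i := by
  obtain ⟨b, hb⟩ := exists_basis_of_span_eq_top hf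
  choose d hd hbd using hb
  exact ⟨b, d, hd, hbd⟩

lemma PosDiag.eq_smul_of_pow [FiniteDimensional ℝ V] {f : End ℝ V} (hf : PosDiag f)
    {μ : ℝ} {k : ℕ} {v : V} (h : ((f - algebraMap ℝ (End ℝ V) μ) ^ k) v = 0) : f v = μ • v := by
  obtain ⟨b, d, hd, hb⟩ := hf.exists_basis
  have key : ∀ (k : ℕ) (v : V) i,
      b.repr (((f - algebraMap ℝ (End ℝ V) μ) ^ k) v) i = (d i - μ) ^ k * b.repr v i := by
    intro k v i
    have : (b.coord i) ∘ₗ ((f - algebraMap ℝ (End ℝ V) μ) ^ k) = ((d i - μ) ^ k) • b.coord i := by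
      apply b.ext
      intro j
      have hj : ((f - algebraMap ℝ (End ℝ V) μ) ^ k) (b j) = (d j - μ) ^ k • b j := by
        induction k with
        | zero => simp
        | succ k ih =>
          rw [pow_succ', End.mul_apply, ih, map_smul]
          simp only [LinearMap.sub_apply, hb, algebraMap_end_apply, ← sub_smul, smul_smul, pow_succ]
      rw [LinearMap.comp_apply, hj]
      by_cases hij : j = i
      · subst hij; simp
      · simp [hij]
    simpa using LinearMap.congr_fun this v
  rw [← sub_eq_zero]
  apply b.ext_elem
  intro i
  have h1 := key 1 v i
  have h2 := key k v i
  rw [h] at h2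
  simp only [pow_one, LinearMap.sub_apply, algebraMap_end_apply] at h1
  rw [h1]
  rcases mul_eq_zero.1 (by simpa using h2.symm : (d i - μ) ^ k * b.repr v i = 0) with h3 | h3
  · simp [eq_zero_of_pow_eq_zero h3]
  · simp [h3]

lemma PosDiag.pos_of_eigen [FiniteDimensional ℝ V] {f : End ℝ V} (hf : PosDiag f)
    {μ : ℝ} {v : V} (hv : v ≠ 0) (h : f v = μ • v) : 0 < μ := by
  obtain ⟨b, d, hd, hb⟩ := hf.exists_basis
  have : ∃ i, b.repr v i ≠ 0 := by
    by_contra! hc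
    exact hv (b.ext_elem (by simpa using hc))
  obtain ⟨i, hi⟩ := this
  have : (b.coord i) ∘ₗ f = d i • b.coord i := by
    apply b.ext
    intro j
    by_cases hij : j = i
    · subst hij; simp [hb]
    · simp [hb, hij]
  have h2 := LinearMap.congr_fun this v
  simp only [LinearMap.comp_apply, h, map_smul, Basis.coord_apply, smul_eq_mul,
    LinearMap.smul_apply] at h2
  rw [mul_right_cancel₀ hi h2]
  exact hd i

lemma PosDiag.iSup_eigenspace {f : End ℝ V} (hf : PosDiag f) : ⨆ μ, f.eigenspace μ = ⊤ := by
  rw [eq_top_iff, ← hf, Submodule.span_le]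
  rintro v ⟨μ, -, hv⟩
  exact Submodule.mem_iSup_of_mem μ (End.mem_eigenspace_iff.2 hv)

lemma PosDiag.restrict [FiniteDimensional ℝ V] {f : End ℝ V} (hf : PosDiag f)
    {W : Submodule ℝ V} (hW : ∀ x ∈ W, f x ∈ W) : PosDiag (f.restrict hW) := by
  rw [PosDiag, ← Submodule.map_injective_of_injective W.injective_subtype |>.eq_iff,
    Submodule.map_span, Submodule.map_top, Submodule.range_subtype]
  apply le_antisymm
  · rw [Submodule.span_le]
    rintro _ ⟨x, -, rfl⟩
    exact x.2
  · conv_lhs => rw [Submodule.eq_iSup_inf_genEigenspace 1 hW hf.iSup_eigenspace]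
    apply iSup_le
    rintro μ x ⟨hx, hx'⟩
    have hx' : f x = μ • x := End.mem_eigenspace_iff.1 hx'
    by_cases h0 : x = 0
    · subst h0; exact Submodule.zero_mem _
    · exact Submodule.subset_span ⟨⟨x, hx⟩, ⟨μ, hf.pos_of_eigen h0 hx', Subtype.ext hx'⟩, rfl⟩

lemma PosDiag.mapQ {f : End ℝ V} (hf : PosDiag f)
    {W : Submodule ℝ V} (hW : W ≤ W.comap f) : PosDiag (W.mapQ W f hW) := by
  rw [PosDiag, eq_top_iff, ← Submodule.range_mkQ W, ← Submodule.map_top, ← hf, Submodule.map_span]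
  apply Submodule.span_mono
  rintro _ ⟨v, ⟨μ, hμ, hv⟩, rfl⟩
  exact ⟨μ, hμ, by simp [hv]⟩

variable {Γ : Type*} [Group Γ]

lemma PosDiag.eq_one_of_quot [FiniteDimensional ℝ V] {f : End ℝ V} (hf : PosDiag f)
    {W : Submodule ℝ V} (h1 : ∀ x ∈ W, f x = x) (h2 : ∀ x, f x - x ∈ W) : f = 1 := by
  ext v
  have := hf.eq_smul_of_pow (μ := 1) (k := 2) (v := v) (by
    simp [pow_two, End.mul_apply, h1 _ (h2 v)])
  simpa using this

/-- If a group of positively diagonalizable endomorphisms acts commutatively on an invariant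
subspace and on the quotient by it, it is commutative. -/
lemma commute_of_invariant [FiniteDimensional ℝ V] (ρ : Γ →* End ℝ V)
    (hρ : ∀ g, PosDiag (ρ g)) (W : Submodule ℝ V)
    (g h : Γ)
    (hsub : ∀ x ∈ W, ρ g (ρ h x) = ρ h (ρ g x)) (hW : ∀ (g : Γ), ∀ x ∈ W, ρ g x ∈ W)
    (hquot : ∀ x, ρ g (ρ h x) - ρ h (ρ g x) ∈ W) : Commute (ρ g) (ρ h) := by
  have inv : ∀ (k : Γ) x, ρ k (ρ k⁻¹ x) = x := fun k x => by
    rw [← End.mul_apply, ← map_mul]; simp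
  have inv' : ∀ (k : Γ) x, ρ k⁻¹ (ρ k x) = x := fun k x => by
    rw [← End.mul_apply, ← map_mul]; simp
  have key : ρ (g⁻¹ * h⁻¹ * g * h) = 1 := by
    apply (hρ _).eq_one_of_quot (W := W)
    · intro x hx
      simp only [map_mul, End.mul_apply, hsub x hx, inv']
    · intro x
      have : ρ (g⁻¹ * h⁻¹ * g * h) x - x = ρ g⁻¹ (ρ h⁻¹ (ρ g (ρ h x) - ρ h (ρ g x))) := by
        simp only [map_mul, End.mul_apply, map_sub, inv']
      rw [this]
      exact hW _ _ (hW _ _ (hquot x))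
  have h2 : ρ (g * h) = ρ (h * g) * ρ (g⁻¹ * h⁻¹ * g * h) := by
    rw [← map_mul]; congr 1; group
  rw [key, mul_one, map_mul, map_mul] at h2
  exact h2

end PosDiag

section Tangent

open Topology

variable {Γ E : Type*} [Group Γ] [NormedRing E] [NormedAlgebra ℝ E]

/-- `X` is tangent at the identity to the image of `σ`. -/
def IsTangent (σ : Γ →* E) (X : E) : Prop :=
  ∃ u : ℝ → Γ, Tendsto (fun ε => ε⁻¹ • (σ (u ε) - 1)) (𝓝[>] 0) (𝓝 X)

lemma tendsto_one_of_tangent {σ : Γ →* E} {X : E} {u : ℝ → Γ}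
    (hu : Tendsto (fun ε => ε⁻¹ • (σ (u ε) - 1)) (𝓝[>] 0) (𝓝 X)) :
    Tendsto (fun ε => σ (u ε)) (𝓝[>] 0) (𝓝 1) := by
  have h0 : Tendsto (fun ε : ℝ => ε) (𝓝[>] 0) (𝓝 0) := tendsto_nhdsWithin_of_tendsto_nhds tendsto_id
  have h1 := ((h0.smul hu).const_add (1 : E))
  simp only [zero_smul, add_zero] at h1
  refine h1.congr' ?_
  filter_upwards [self_mem_nhdsWithin] with ε hε
  rw [smul_smul, mul_inv_cancel₀ (ne_of_gt hε), one_smul, add_sub_cancel]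

lemma map_inv_eq_ringInverse (σ : Γ →* E) (g : Γ) : σ g⁻¹ = Ring.inverse (σ g) := by
  have : σ g = ((Units.map σ (toUnits g) : Eˣ) : E) := rfl
  rw [this, Ring.inverse_unit]
  rfl

lemma tendsto_inv_of_tangent [CompleteSpace E] {σ : Γ →* E} {X : E} {u : ℝ → Γ}
    (hu : Tendsto (fun ε => ε⁻¹ • (σ (u ε) - 1)) (𝓝[>] 0) (𝓝 X)) :
    Tendsto (fun ε => σ (u ε)⁻¹) (𝓝[>] 0) (𝓝 1) := by
  simp only [map_inv_eq_ringInverse]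
  have := (NormedRing.inverse_continuousAt (1 : Eˣ)).tendsto
  simp only [Units.val_one, Ring.inverse_one] at this
  exact this.comp (tendsto_one_of_tangent hu)

lemma tangent_inv [CompleteSpace E] {σ : Γ →* E} {X : E} {u : ℝ → Γ}
    (hu : Tendsto (fun ε => ε⁻¹ • (σ (u ε) - 1)) (𝓝[>] 0) (𝓝 X)) :
    Tendsto (fun ε => ε⁻¹ • (σ (u ε)⁻¹ - 1)) (𝓝[>] 0) (𝓝 (-X)) := by
  have h := ((tendsto_inv_of_tangent hu).mul hu).neg
  rw [one_mul] at h
  refine h.congr fun ε => ?_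
  rw [mul_smul_comm, mul_sub, ← map_mul, inv_mul_cancel, map_one, mul_one, ← smul_neg, neg_sub]

lemma isTangent_zero (σ : Γ →* E) : IsTangent σ 0 := ⟨fun _ => 1, by simp⟩

lemma IsTangent.add {σ : Γ →* E} {X Y : E} (hX : IsTangent σ X) (hY : IsTangent σ Y) :
    IsTangent σ (X + Y) := by
  obtain ⟨u, hu⟩ := hX
  obtain ⟨v, hv⟩ := hY
  refine ⟨fun ε => u ε * v ε, ?_⟩
  have h := (hu.mul (tendsto_one_of_tangent hv)).add hv
  rw [mul_one] at h
  refine h.congr fun ε => ?_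
  rw [map_mul, smul_mul_assoc, ← smul_add, sub_mul, one_mul, sub_add_sub_cancel]

lemma IsTangent.neg [CompleteSpace E] {σ : Γ →* E} {X : E} (hX : IsTangent σ X) :
    IsTangent σ (-X) := by
  obtain ⟨u, hu⟩ := hX
  exact ⟨fun ε => (u ε)⁻¹, tangent_inv hu⟩

lemma IsTangent.smul_of_pos {σ : Γ →* E} {X : E} (hX : IsTangent σ X) {c : ℝ} (hc : 0 < c) :
    IsTangent σ (c • X) := by
  obtain ⟨u, hu⟩ := hX
  refine ⟨fun ε => u (c * ε), ?_⟩
  have h0 : Tendsto (fun ε : ℝ => c * ε) (𝓝[>] 0) (𝓝[>] 0) := by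
    apply tendsto_nhdsWithin_of_tendsto_nhds_of_eventually_within
    · have : Tendsto (fun ε : ℝ => c * ε) (𝓝 0) (𝓝 (c * 0)) := tendsto_id.const_mul c
      rw [mul_zero] at this
      exact tendsto_nhdsWithin_of_tendsto_nhds this
    · filter_upwards [self_mem_nhdsWithin] with ε hε
      exact mul_pos hc hε
  refine ((hu.comp h0).const_smul c).congr fun ε => ?_
  simp only [Function.comp, smul_smul]
  congr 1
  field_simp

/-- The tangent space at the identity of the image of `σ`. -/
def tangentSpace [CompleteSpace E] (σ : Γ →* E) : Submodule ℝ E where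
  carrier := {X | IsTangent σ X}
  zero_mem' := isTangent_zero σ
  add_mem' := IsTangent.add
  smul_mem' := by
    intro c X hX
    rcases lt_trichotomy c 0 with hc | rfl | hc
    · have := (IsTangent.neg hX).smul_of_pos (neg_pos.2 hc)
      rwa [smul_neg, neg_smul, neg_neg] at this
    · simpa using isTangent_zero σ
    · exact IsTangent.smul_of_pos hX hc

lemma IsTangent.conj {σ : Γ →* E} {X : E} (hX : IsTangent σ X) (g : Γ) :
    IsTangent σ (σ g * X * σ g⁻¹) := by
  obtain ⟨u, hu⟩ := hX
  refine ⟨fun ε => g * u ε * g⁻¹, ?_⟩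
  refine ((hu.const_mul (σ g)).mul_const (σ g⁻¹)).congr fun ε => ?_
  rw [map_mul, map_mul, mul_smul_comm, smul_mul_assoc, mul_sub, sub_mul, mul_one, ← map_mul σ g g⁻¹,
    mul_inv_cancel, map_one]

/-- A closed subspace stable under conjugation is stable under brackets with tangent vectors. -/
lemma IsTangent.bracket_mem [CompleteSpace E] {σ : Γ →* E} {X : E} (hX : IsTangent σ X)
    {R : Submodule ℝ E} (hR : IsClosed (R : Set E))
    (hconj : ∀ g, ∀ Y ∈ R, σ g * Y * σ g⁻¹ ∈ R) {Y : E} (hY : Y ∈ R) : X * Y - Y * X ∈ R := by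
  obtain ⟨u, hu⟩ := hX
  have h := ((hu.mul_const Y).mul (tendsto_inv_of_tangent hu)).add
    ((tangent_inv hu).const_mul Y)
  rw [mul_one, mul_neg, ← sub_eq_add_neg] at h
  refine hR.mem_of_tendsto h (Eventually.of_forall fun ε => ?_)
  have : ε⁻¹ • (σ (u ε) - 1) * Y * σ (u ε)⁻¹ + Y * ε⁻¹ • (σ (u ε)⁻¹ - 1)
      = ε⁻¹ • (σ (u ε) * Y * σ (u ε)⁻¹ - Y) := by
    simp only [smul_mul_assoc, mul_smul_comm, ← smul_add, sub_mul, mul_sub, one_mul, mul_one,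
      sub_add_sub_cancel]
  rw [this]
  exact R.smul_mem _ (R.sub_mem (hconj _ _ hY) hY)

lemma norm_one_add_pow_sub_le [NormOneClass E] (Z : E) (m : ℕ) :
    ‖(1 + Z) ^ m - 1 - m • Z‖ ≤ (1 + ‖Z‖) ^ m - 1 - m * ‖Z‖ := by
  induction m with
  | zero => simp
  | succ m ih =>
    have e : (1 + Z) ^ (m + 1) - 1 - (m + 1) • Z
        = (1 + Z) * ((1 + Z) ^ m - 1 - m • Z) + m • (Z * Z) := by
      rw [pow_succ', mul_sub, mul_sub, add_smul, one_smul, mul_one, add_mul (1 : E) Z (m • Z),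
        one_mul, mul_smul_comm]
      abel
    rw [e]
    refine (norm_add_le _ _).trans ?_
    have h1 : ‖(1 + Z) * ((1 + Z) ^ m - 1 - m • Z)‖
        ≤ (1 + ‖Z‖) * ((1 + ‖Z‖) ^ m - 1 - m * ‖Z‖) := by
      refine (norm_mul_le _ _).trans (mul_le_mul ?_ ih (norm_nonneg _) (by positivity))
      exact (norm_add_le _ _).trans (by rw [norm_one])
    have h2 : ‖m • (Z * Z)‖ ≤ m * (‖Z‖ * ‖Z‖) :=
      (norm_nsmul_le).trans (by gcongr; exact norm_mul_le _ _)
    refine (add_le_add h1 h2).trans (le_of_eq ?_)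
    push_cast
    ring

lemma norm_one_add_pow_sub_le_sq [NormOneClass E] (Z : E) (m : ℕ) (h : m * ‖Z‖ ≤ 1) :
    ‖(1 + Z) ^ m - 1 - m • Z‖ ≤ (m * ‖Z‖) ^ 2 := by
  refine (norm_one_add_pow_sub_le Z m).trans ?_
  have h1 : (1 + ‖Z‖) ^ m ≤ Real.exp (m * ‖Z‖) := by
    rw [Real.exp_nat_mul]
    gcongr
    rw [add_comm]; exact Real.add_one_le_exp _
  have h2 := Real.abs_exp_sub_one_sub_id_le (x := m * ‖Z‖) (by
    rw [abs_of_nonneg (by positivity)]; exact h)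
  have h3 := (abs_le.1 h2).2
  linarith

/-- If the image of `σ` accumulates at the identity, it has a nonzero tangent vector. -/
lemma exists_isTangent_ne_zero [NormOneClass E] [FiniteDimensional ℝ E] (σ : Γ →* E)
    (h : ∀ η > 0, ∃ g, σ g ≠ 1 ∧ ‖σ g - 1‖ < η) : ∃ X, X ≠ 0 ∧ IsTangent σ X := by
  have : ProperSpace E := FiniteDimensional.proper ℝ E
  choose g hg1 hg2 using fun k : ℕ => h (1 / ((k : ℝ) + 1)) (by positivity)
  set Z : ℕ → E := fun k => σ (g k) - 1 with hZ
  have hZ0 : ∀ k, 0 < ‖Z k‖ := fun k => norm_pos_iff.2 (sub_ne_zero.2 (hg1 k))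
  have hZt : Tendsto (fun k => ‖Z k‖) atTop (𝓝 0) :=
    squeeze_zero (fun k => norm_nonneg _) (fun k => (hg2 k).le) tendsto_one_div_add_atTop_nhds_zero_nat
  obtain ⟨X, hX, φ, hφ, hlim⟩ := (isCompact_sphere (0 : E) 1).tendsto_subseq
    (x := fun k => ‖Z k‖⁻¹ • Z k) (fun k => by
      simp [norm_smul, (hZ0 k).ne'])
  refine ⟨X, ?_, ?_⟩
  · rintro rfl
    simp at hX
  have hX1 : ‖X‖ = 1 := by simpa using hX
  have hex : ∀ ε : ℝ, ∃ k, 0 < ε → ‖Z k‖ ≤ ε ^ 2 ∧ ‖‖Z k‖⁻¹ • Z k - X‖ ≤ ε := by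
    intro ε
    by_cases hε : 0 < ε
    · have e1 := (hZt.comp hφ.tendsto_atTop).eventually (ge_mem_nhds (show 0 < ε ^ 2 by positivity))
      have e2 := (tendsto_iff_norm_sub_tendsto_zero.1 hlim).eventually (ge_mem_nhds hε)
      obtain ⟨k, h1, h2⟩ := (e1.and e2).exists
      exact ⟨φ k, fun _ => ⟨h1, h2⟩⟩
    · exact ⟨0, fun h => absurd h hε⟩
  choose k hk using hex
  refine ⟨fun ε => g (k ε) ^ ⌊ε / ‖Z (k ε)‖⌋₊, ?_⟩
  rw [tendsto_iff_norm_sub_tendsto_zero]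
  have h3 : Tendsto (fun ε : ℝ => 3 * ε) (𝓝[>] 0) (𝓝 0) := by
    have : Tendsto (fun ε : ℝ => 3 * ε) (𝓝 0) (𝓝 (3 * 0)) := tendsto_id.const_mul 3
    rw [mul_zero] at this
    exact tendsto_nhdsWithin_of_tendsto_nhds this
  refine squeeze_zero' (Eventually.of_forall fun _ => norm_nonneg _) ?_ h3
  filter_upwards [Ioo_mem_nhdsGT (show (0 : ℝ) < 1 by norm_num)] with ε hε
  obtain ⟨hε0, hε1⟩ := hε
  obtain ⟨ha, hb⟩ := hk ε hε0
  set z := ‖Z (k ε)‖ with hz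
  have hzp : 0 < z := hZ0 _
  set m := ⌊ε / z⌋₊ with hm
  have hmz : m * z ≤ ε := by
    have := Nat.floor_le (show 0 ≤ ε / z by positivity)
    rwa [le_div_iff₀ hzp] at this
  have hmz' : ε - z ≤ m * z := by
    have := (Nat.lt_floor_add_one (ε / z)).le
    rw [div_le_iff₀ hzp] at this
    linarith
  have hσ : σ (g (k ε) ^ m) = (1 + Z (k ε)) ^ m := by simp [hZ]
  have b1 := norm_one_add_pow_sub_le_sq (Z (k ε)) m (hmz.trans hε1.le)
  have b2 : ‖m • Z (k ε) - ε • X‖ ≤ 2 * ε ^ 2 := by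
    have e : m • Z (k ε) - ε • X = (m * z) • (z⁻¹ • Z (k ε) - X) - (ε - m * z) • X := by
      rw [smul_sub ((m : ℝ) * z), smul_smul, mul_assoc, mul_inv_cancel₀ hzp.ne', mul_one, sub_smul,
        Nat.cast_smul_eq_nsmul]
      abel
    rw [e]
    refine (norm_sub_le _ _).trans ?_
    rw [norm_smul, norm_smul, hX1, Real.norm_of_nonneg (by positivity),
      Real.norm_of_nonneg (by linarith)]
    have : m * z * ‖z⁻¹ • Z (k ε) - X‖ ≤ ε * ε := by gcongr
    nlinarith
  have b3 : ‖σ (g (k ε) ^ m) - 1 - ε • X‖ ≤ 3 * ε ^ 2 := by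
    have e : σ (g (k ε) ^ m) - 1 - ε • X
        = ((1 + Z (k ε)) ^ m - 1 - m • Z (k ε)) + (m • Z (k ε) - ε • X) := by
      rw [hσ]; abel
    rw [e]
    refine (norm_add_le _ _).trans ?_
    have : (m * z) ^ 2 ≤ ε ^ 2 := by gcongr
    linarith
  have e : ε⁻¹ • (σ (g (k ε) ^ m) - 1) - X = ε⁻¹ • (σ (g (k ε) ^ m) - 1 - ε • X) := by
    rw [smul_sub _ _ (ε • X), smul_smul, inv_mul_cancel₀ hε0.ne', one_smul]
  rw [e, norm_smul, Real.norm_of_nonneg (by positivity), inv_mul_le_iff₀ hε0]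
  nlinarith

end Tangent

section Core

open Topology
open scoped Matrix.Norms.L2Operator

variable {Γ : Type*} [Group Γ] {d : ℕ}

/-- Conjugate over `ℝ` to a diagonal matrix with positive entries. -/
def ConjDiagPos (a : Matrix (Fin d) (Fin d) ℝ) : Prop :=
  ∃ P : Matrix (Fin d) (Fin d) ℝ, IsUnit P.det ∧
    ∃ l : Fin d → ℝ, (∀ i, 0 < l i) ∧ a = P * Matrix.diagonal l * P⁻¹

lemma det_smul_sub_conj_diagonal {P : Matrix (Fin d) (Fin d) ℝ} (hP : IsUnit P.det)
    (l : Fin d → ℝ) (s : ℝ) :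
    (s • 1 - P * Matrix.diagonal l * P⁻¹).det = ∏ i, (s - l i) := by
  have : s • 1 - P * Matrix.diagonal l * P⁻¹ = P * (Matrix.diagonal fun i => s - l i) * P⁻¹ := by
    have h1 : (Matrix.diagonal fun i => s - l i) = s • (1 : Matrix (Fin d) (Fin d) ℝ) -
        Matrix.diagonal l := by
      rw [← Matrix.diagonal_one, ← Matrix.diagonal_smul, Matrix.diagonal_sub]
      simp
    rw [h1, mul_sub, sub_mul, mul_smul_comm, mul_one, smul_mul_assoc, Matrix.mul_nonsing_inv _ hP]
  rw [this, Matrix.det_conj ((Matrix.isUnit_iff_isUnit_det _).2 hP), Matrix.det_diagonal]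

lemma trace_conj_eq {P : Matrix (Fin d) (Fin d) ℝ} (hP : IsUnit P.det)
    (D : Matrix (Fin d) (Fin d) ℝ) : (P * D * P⁻¹).trace = D.trace := by
  rw [Matrix.trace_mul_comm, ← mul_assoc, Matrix.nonsing_inv_mul _ hP, one_mul]

lemma det_conj_eq {P : Matrix (Fin d) (Fin d) ℝ} (hP : IsUnit P.det)
    (D : Matrix (Fin d) (Fin d) ℝ) : (P * D * P⁻¹).det = D.det :=
  Matrix.det_conj ((Matrix.isUnit_iff_isUnit_det _).2 hP) D

lemma tangent_spectrum {σ : Γ →* Matrix (Fin d) (Fin d) ℝ}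
    (hdiag : ∀ g, ConjDiagPos (σ g)) (hdet : ∀ g, (σ g).det = 1)
    {X : Matrix (Fin d) (Fin d) ℝ} (hX : IsTangent σ X) :
    ∃ τ : Fin d → ℝ, (∀ s : ℝ, (s • 1 - X).det = ∏ i, (s - τ i)) ∧
      (X * X).trace = ∑ i, τ i ^ 2 ∧ 0 ≤ X.trace := by
  obtain ⟨u, hu⟩ := hX
  have hε : Tendsto (fun k : ℕ => 1 / ((k : ℝ) + 1)) atTop (𝓝[>] 0) :=
    tendsto_nhdsWithin_of_tendsto_nhds_of_eventually_within _ tendsto_one_div_add_atTop_nhds_zero_nat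
      (Eventually.of_forall fun k => by simp only [Set.mem_Ioi]; positivity)
  have hT := hu.comp hε
  set T : ℕ → Matrix (Fin d) (Fin d) ℝ := _ with hTdef
  change Tendsto T atTop (𝓝 X) at hT
  have key : ∀ k, ∃ P : Matrix (Fin d) (Fin d) ℝ, IsUnit P.det ∧ ∃ τ : Fin d → ℝ,
      T k = P * Matrix.diagonal τ * P⁻¹ ∧ 0 ≤ ∑ i, τ i := by
    intro k
    obtain ⟨P, hP, l, hl, hg⟩ := hdiag (u (1 / ((k : ℝ) + 1)))
    set e : ℝ := 1 / ((k : ℝ) + 1) with he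
    have hepos : 0 < e := by positivity
    refine ⟨P, hP, fun i => e⁻¹ * (l i - 1), ?_, ?_⟩
    · have h1 : (Matrix.diagonal fun i => e⁻¹ * (l i - 1)) = e⁻¹ • (Matrix.diagonal l -
          (1 : Matrix (Fin d) (Fin d) ℝ)) := by
        rw [← Matrix.diagonal_one, Matrix.diagonal_sub, ← Matrix.diagonal_smul]
        rfl
      rw [h1, mul_smul_comm, smul_mul_assoc, mul_sub, sub_mul, mul_one,
        Matrix.mul_nonsing_inv _ hP, ← hg]
      rfl
    · rw [← Finset.mul_sum]
      refine mul_nonneg (by positivity) ?_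
      have hprod : ∏ i, l i = 1 := by
        rw [← Matrix.det_diagonal, ← det_conj_eq hP, ← hg, hdet]
      have hlog : ∑ i, Real.log (l i) = 0 := by
        rw [← Real.log_prod (fun i _ => (hl i).ne'), hprod, Real.log_one]
      rw [← hlog]
      exact Finset.sum_le_sum fun i _ => Real.log_le_sub_one_of_pos (hl i)
  choose P hP τ hτ hτ0 using key
  have htr2 : ∀ k, (T k * T k).trace = ∑ i, τ k i ^ 2 := by
    intro k
    have : T k * T k = P k * (Matrix.diagonal fun i => τ k i ^ 2) * (P k)⁻¹ := by
      have h1 : (Matrix.diagonal fun i => τ k i ^ 2) = Matrix.diagonal (τ k) * Matrix.diagonal (τ k) := by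
        rw [Matrix.diagonal_mul_diagonal]
        simp [pow_two]
      rw [hτ, h1]
      have : (P k)⁻¹ * P k = 1 := Matrix.nonsing_inv_mul _ (hP k)
      simp only [mul_assoc]
      rw [← mul_assoc _ (P k), this, one_mul]
    rw [this, trace_conj_eq (hP k), Matrix.trace_diagonal]
  have htr2lim : Tendsto (fun k => (T k * T k).trace) atTop (𝓝 (X * X).trace) :=
    ((continuous_id.matrix_trace).tendsto _).comp (hT.mul hT)
  have htrlim : Tendsto (fun k => (T k).trace) atTop (𝓝 X.trace) :=
    ((continuous_id.matrix_trace).tendsto _).comp hT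
  have htr0 : 0 ≤ X.trace := ge_of_tendsto' htrlim fun k => by
    rw [hτ, trace_conj_eq (hP k), Matrix.trace_diagonal]; exact hτ0 k
  obtain ⟨M, hM⟩ := htr2lim.bddAbove_range
  have hbd : ∀ k, τ k ∈ Metric.closedBall (0 : Fin d → ℝ) (Real.sqrt M) := by
    intro k
    rw [mem_closedBall_zero_iff, pi_norm_le_iff_of_nonneg (Real.sqrt_nonneg _)]
    intro i
    apply Real.abs_le_sqrt
    calc τ k i ^ 2 ≤ ∑ i, τ k i ^ 2 :=
          Finset.single_le_sum (f := fun i => τ k i ^ 2) (fun i _ => sq_nonneg _) (Finset.mem_univ i)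
      _ = _ := (htr2 k).symm
      _ ≤ M := hM ⟨k, rfl⟩
  obtain ⟨t, -, φ, hφ, hlim⟩ := (isCompact_closedBall (0 : Fin d → ℝ) (Real.sqrt M)).tendsto_subseq hbd
  have hlim' := tendsto_pi_nhds.1 hlim
  refine ⟨t, fun s => ?_, ?_, htr0⟩
  · have h1 : Tendsto (fun k => (s • 1 - T (φ k)).det) atTop (𝓝 (s • 1 - X).det) := by
      have hc : Continuous fun Y : Matrix (Fin d) (Fin d) ℝ => (s • 1 - Y).det :=
        (continuous_const.sub continuous_id).matrix_det
      exact (hc.tendsto X).comp (hT.comp hφ.tendsto_atTop)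
    refine tendsto_nhds_unique h1 ?_
    simp only [hτ, det_smul_sub_conj_diagonal (hP _)]
    exact tendsto_finsetProd _ fun i _ => (hlim' i).const_sub s
  · refine tendsto_nhds_unique (htr2lim.comp hφ.tendsto_atTop) ?_
    simp only [Function.comp_def, htr2]
    exact tendsto_finsetSum _ fun i _ => (hlim' i).pow 2

lemma pow_eq_zero_of_det {X : Matrix (Fin d) (Fin d) ℝ}
    (h : ∀ s : ℝ, (s • 1 - X).det = s ^ d) : X ^ d = 0 := by
  have : X.charpoly = Polynomial.X ^ d := by
    apply Polynomial.funext
    intro s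
    rw [Matrix.eval_charpoly, Polynomial.eval_pow, Polynomial.eval_X, ← h,
      Matrix.scalar_apply, ← Matrix.smul_one_eq_diagonal]
  have h2 := Matrix.aeval_self_charpoly X
  rwa [this, map_pow, Polynomial.aeval_X] at h2

lemma tangent_trace_sq_nonneg {σ : Γ →* Matrix (Fin d) (Fin d) ℝ}
    (hdiag : ∀ g, ConjDiagPos (σ g)) (hdet : ∀ g, (σ g).det = 1)
    {X : Matrix (Fin d) (Fin d) ℝ} (hX : IsTangent σ X) : 0 ≤ (X * X).trace := by
  obtain ⟨τ, -, h, -⟩ := tangent_spectrum hdiag hdet hX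
  rw [h]
  positivity

lemma tangent_trace_eq_zero {σ : Γ →* Matrix (Fin d) (Fin d) ℝ}
    (hdiag : ∀ g, ConjDiagPos (σ g)) (hdet : ∀ g, (σ g).det = 1)
    {X : Matrix (Fin d) (Fin d) ℝ} (hX : IsTangent σ X) : X.trace = 0 := by
  obtain ⟨_, -, -, h1⟩ := tangent_spectrum hdiag hdet hX
  obtain ⟨_, -, -, h2⟩ := tangent_spectrum hdiag hdet hX.neg
  rw [Matrix.trace_neg] at h2
  linarith

lemma tangent_pow_eq_zero {σ : Γ →* Matrix (Fin d) (Fin d) ℝ}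
    (hdiag : ∀ g, ConjDiagPos (σ g)) (hdet : ∀ g, (σ g).det = 1)
    {X : Matrix (Fin d) (Fin d) ℝ} (hX : IsTangent σ X) (h0 : (X * X).trace = 0) : X ^ d = 0 := by
  obtain ⟨τ, h1, h2, -⟩ := tangent_spectrum hdiag hdet hX
  rw [h0] at h2
  have hτ : ∀ i, τ i = 0 := fun i => by
    have := (Finset.sum_eq_zero_iff_of_nonneg (fun i _ => sq_nonneg (τ i))).1 h2.symm i
      (Finset.mem_univ i)
    exact pow_eq_zero_iff (two_ne_zero) |>.1 this
  apply pow_eq_zero_of_det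
  intro s
  rw [h1]
  simp [hτ]

lemma tangent_trace_mul_eq_zero {σ : Γ →* Matrix (Fin d) (Fin d) ℝ}
    (hdiag : ∀ g, ConjDiagPos (σ g)) (hdet : ∀ g, (σ g).det = 1)
    {X Y : Matrix (Fin d) (Fin d) ℝ} (hX : IsTangent σ X) (hY : IsTangent σ Y)
    (h0 : (X * X).trace = 0) (h0' : (Y * Y).trace = 0) : (X * Y).trace = 0 := by
  have h1 := tangent_trace_sq_nonneg hdiag hdet (hX.add hY)
  have h2 := tangent_trace_sq_nonneg hdiag hdet (hX.add hY.neg)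
  simp only [mul_add, add_mul, Matrix.trace_add, Matrix.mul_neg, Matrix.neg_mul, Matrix.trace_neg,
    h0, h0', Matrix.trace_mul_comm Y X] at h1 h2
  linarith

/-- The tangent vectors of trace-square zero. -/
def tangentRadical (σ : Γ →* Matrix (Fin d) (Fin d) ℝ)
    (hdiag : ∀ g, ConjDiagPos (σ g)) (hdet : ∀ g, (σ g).det = 1) :
    Submodule ℝ (Matrix (Fin d) (Fin d) ℝ) where
  carrier := {X | IsTangent σ X ∧ (X * X).trace = 0}
  zero_mem' := ⟨isTangent_zero σ, by simp⟩
  add_mem' := by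
    rintro X Y ⟨hX, hX0⟩ ⟨hY, hY0⟩
    refine ⟨hX.add hY, ?_⟩
    have := tangent_trace_mul_eq_zero hdiag hdet hX hY hX0 hY0
    simp only [mul_add, add_mul, Matrix.trace_add, hX0, hY0, this, Matrix.trace_mul_comm Y X,
      add_zero]
  smul_mem' := by
    rintro c X ⟨hX, hX0⟩
    refine ⟨(tangentSpace σ).smul_mem c hX, ?_⟩
    simp [hX0]

lemma map_inv_mul_self {M : Type*} [Monoid M] (σ : Γ →* M) (g : Γ) : σ g⁻¹ * σ g = 1 := by
  rw [← map_mul, inv_mul_cancel, map_one]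

lemma map_mul_inv_self {M : Type*} [Monoid M] (σ : Γ →* M) (g : Γ) : σ g * σ g⁻¹ = 1 := by
  rw [← map_mul, mul_inv_cancel, map_one]

lemma tangentRadical_conj {σ : Γ →* Matrix (Fin d) (Fin d) ℝ}
    {hdiag : ∀ g, ConjDiagPos (σ g)} {hdet : ∀ g, (σ g).det = 1} (g : Γ)
    {X : Matrix (Fin d) (Fin d) ℝ} (hX : X ∈ tangentRadical σ hdiag hdet) :
    σ g * X * σ g⁻¹ ∈ tangentRadical σ hdiag hdet := by
  refine ⟨hX.1.conj g, ?_⟩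
  have : σ g * X * σ g⁻¹ * (σ g * X * σ g⁻¹) = σ g * (X * X * σ g⁻¹) := by
    simp only [mul_assoc]
    rw [← mul_assoc (σ g⁻¹), map_inv_mul_self, one_mul]
  rw [this, Matrix.trace_mul_comm, mul_assoc, map_inv_mul_self, mul_one, hX.2]

attribute [local instance] LieRing.ofAssociativeRing

/-- The radical as a Lie algebra of endomorphisms. -/
def tangentRadicalLie (σ : Γ →* Matrix (Fin d) (Fin d) ℝ)
    (hdiag : ∀ g, ConjDiagPos (σ g)) (hdet : ∀ g, (σ g).det = 1) :
    LieSubalgebra ℝ (Module.End ℝ (Fin d → ℝ)) where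
  toSubmodule := (tangentRadical σ hdiag hdet).comap
    (LinearMap.toMatrix' : Module.End ℝ (Fin d → ℝ) ≃ₗ[ℝ] _).toLinearMap
  lie_mem' := by
    intro f g hf hg
    change LinearMap.toMatrix' (f * g - g * f) ∈ tangentRadical σ hdiag hdet
    rw [map_sub, LinearMap.toMatrix'_mul, LinearMap.toMatrix'_mul]
    exact hf.1.bracket_mem (Submodule.closed_of_finiteDimensional _)
      (fun g Y hY => tangentRadical_conj g hY) hg

/-- Engel's theorem gives a common kernel vector for the radical. -/
lemma exists_common_kernel [Nonempty (Fin d)] (σ : Γ →* Matrix (Fin d) (Fin d) ℝ)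
    (hdiag : ∀ g, ConjDiagPos (σ g)) (hdet : ∀ g, (σ g).det = 1) :
    ∃ v : Fin d → ℝ, v ≠ 0 ∧ ∀ X ∈ tangentRadical σ hdiag hdet, X *ᵥ v = 0 := by
  let L := tangentRadicalLie σ hdiag hdet
  have hnil : LieModule.IsNilpotent L (Fin d → ℝ) := by
    rw [LieModule.isNilpotent_iff_forall' (R := ℝ) (L := L) (M := Fin d → ℝ)]
    intro f
    refine ⟨d, ?_⟩
    have h1 : (LinearMap.toMatrix' (f : Module.End ℝ (Fin d → ℝ))) ^ d = 0 :=
      tangent_pow_eq_zero hdiag hdet f.2.1 f.2.2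
    have h2 : (f : Module.End ℝ (Fin d → ℝ)) ^ d = 0 := by
      apply LinearMap.toMatrix'.injective
      have := map_pow (LinearMap.toMatrixAlgEquiv' (R := ℝ) (n := Fin d)) (f : Module.End ℝ _) d
      rw [map_zero]
      exact this.trans h1
    exact h2
  have hnt := LieModule.nontrivial_max_triv_of_isNilpotent ℝ L (Fin d → ℝ)
  obtain ⟨⟨v, hv⟩, hv0⟩ := exists_ne (0 : LieModule.maxTrivSubmodule ℝ L (Fin d → ℝ))
  refine ⟨v, fun h => hv0 (Subtype.ext h), fun X hX => ?_⟩
  have h3 := (LieModule.mem_maxTrivSubmodule (R := ℝ) (L := L) (M := Fin d → ℝ) v).1 hv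
    ⟨Matrix.toLin' X, by
      change LinearMap.toMatrix' (Matrix.toLin' X) ∈ tangentRadical σ hdiag hdet
      rwa [LinearMap.toMatrix'_toLin']⟩
  exact h3

lemma commute_of_conj_invariant {a b : Matrix (Fin d) (Fin d) ℝ} (ha : ConjDiagPos a)
    (hab : a * b = 1) (hba : b * a = 1) (p : Submodule ℝ (Matrix (Fin d) (Fin d) ℝ))
    (hp : ∀ X ∈ p, a * X * b ∈ p) (hsq : ∀ X ∈ p, (X * X).trace = 0 → X = 0)
    {X : Matrix (Fin d) (Fin d) ℝ} (hX : X ∈ p) : a * X = X * a := by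
  obtain ⟨P, hP, l, hl, hal⟩ := ha
  have hPP : P⁻¹ * P = 1 := Matrix.nonsing_inv_mul _ hP
  have hPP' : P * P⁻¹ = 1 := Matrix.mul_nonsing_inv _ hP
  let f : Module.End ℝ (Matrix (Fin d) (Fin d) ℝ) :=
    LinearMap.mulRight ℝ b ∘ₗ LinearMap.mulLeft ℝ a
  have hf : ∀ X, f X = a * X * b := fun X => rfl
  have hb : b = P * Matrix.diagonal (fun i => (l i)⁻¹) * P⁻¹ := by
    have h1 : (P * Matrix.diagonal (fun i => (l i)⁻¹) * P⁻¹) * a = 1 := by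
      rw [hal]
      simp only [mul_assoc]
      rw [← mul_assoc P⁻¹ P, hPP, one_mul, ← mul_assoc (Matrix.diagonal _) (Matrix.diagonal _),
        Matrix.diagonal_mul_diagonal]
      simp [(hl _).ne', hPP']
    calc b = (P * Matrix.diagonal (fun i => (l i)⁻¹) * P⁻¹) * a * b := by rw [h1, one_mul]
      _ = _ := by rw [mul_assoc, hab, mul_one]
  have htop : ⨆ μ, f.eigenspace μ = ⊤ := by
    rw [eq_top_iff]
    rintro Y -
    have hY : Y = ∑ i, ∑ j, P * Matrix.single i j ((P⁻¹ * Y * P) i j) * P⁻¹ := by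
      simp only [← Finset.sum_mul, ← Finset.mul_sum]
      rw [← Matrix.matrix_eq_sum_single]
      simp only [mul_assoc]
      rw [hPP', mul_one, ← mul_assoc, hPP', one_mul]
    rw [hY]
    refine Submodule.sum_mem _ fun i _ => Submodule.sum_mem _ fun j _ => ?_
    refine Submodule.mem_iSup_of_mem (l i * (l j)⁻¹) (Module.End.mem_eigenspace_iff.2 ?_)
    set c := (P⁻¹ * Y * P) i j
    rw [hf, hal, hb]
    have : P * Matrix.diagonal l * P⁻¹ * (P * Matrix.single i j c * P⁻¹) *
        (P * Matrix.diagonal (fun i => (l i)⁻¹) * P⁻¹) =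
        P * (Matrix.diagonal l * Matrix.single i j c * Matrix.diagonal fun i => (l i)⁻¹) * P⁻¹ := by
      simp only [mul_assoc]
      rw [← mul_assoc P⁻¹ P, hPP, one_mul, ← mul_assoc P⁻¹ P, hPP, one_mul]
    rw [this]
    have h2 : Matrix.diagonal l * Matrix.single i j c * Matrix.diagonal (fun i => (l i)⁻¹) =
        (l i * (l j)⁻¹) • Matrix.single i j c := by
      ext r s
      rw [Matrix.mul_diagonal, Matrix.diagonal_mul, Matrix.smul_apply, Matrix.single_apply,
        smul_eq_mul]
      split_ifs with h
      · obtain ⟨rfl, rfl⟩ := h; ring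
      · ring
    rw [h2, mul_smul_comm, smul_mul_assoc]
  have hle : p ≤ f.eigenspace 1 := by
    rw [Submodule.eq_iSup_inf_genEigenspace (p := p) (f := f) 1 hp htop]
    apply iSup_le
    rintro μ Y ⟨hY, hY'⟩
    have hY' : a * Y * b = μ • Y := Module.End.mem_eigenspace_iff.1 hY'
    by_cases h1 : μ = 1
    · subst h1; exact Module.End.mem_eigenspace_iff.2 hY'
    by_cases h2 : (Y * Y).trace = 0
    · rw [hsq Y hY h2]; exact Submodule.zero_mem _
    exfalso
    have h3 : (a * Y * b * (a * Y * b)).trace = (Y * Y).trace := by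
      have : a * Y * b * (a * Y * b) = a * (Y * Y * b) := by
        simp only [mul_assoc]
        rw [← mul_assoc b a, hba, one_mul]
      rw [this, Matrix.trace_mul_comm, mul_assoc, hba, mul_one]
    rw [hY'] at h3
    simp only [smul_mul_assoc, mul_smul_comm, Matrix.trace_smul, smul_eq_mul] at h3
    have h4 : (μ * μ - 1) * (Y * Y).trace = 0 := by linarith
    have h5 : μ * μ - 1 = 0 := (mul_eq_zero.1 h4).resolve_right h2
    have h6 : μ = -1 := by
      have : (μ - 1) * (μ + 1) = 0 := by linarith
      rcases mul_eq_zero.1 this with h | h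
      · exact absurd (by linarith) h1
      · linarith
    have h7 : Y ≠ 0 := by rintro rfl; simp at h2
    apply h7
    have h8 : a * Y = -(Y * a) := by
      have := congrArg (· * a) hY'
      simp only [mul_assoc, hba, mul_one, h6] at this
      simpa using this
    have h9 : Matrix.diagonal l * (P⁻¹ * Y * P) = -((P⁻¹ * Y * P) * Matrix.diagonal l) := by
      have := congrArg (fun Z => P⁻¹ * Z * P) h8
      rw [hal] at this
      simp only [mul_assoc, mul_neg, neg_mul, hPP, mul_one] at this
      rw [← mul_assoc P⁻¹ P, hPP, one_mul] at this
      simpa only [mul_assoc] using this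
    have h10 : P⁻¹ * Y * P = 0 := by
      ext r s
      have := congrFun (congrFun h9 r) s
      rw [Matrix.neg_apply, Matrix.mul_diagonal, Matrix.diagonal_mul] at this
      have h11 : (l r + l s) * (P⁻¹ * Y * P) r s = 0 := by linarith
      exact (mul_eq_zero.1 h11).resolve_left (add_pos (hl r) (hl s)).ne'
    calc Y = P * (P⁻¹ * Y * P) * P⁻¹ := by
          simp only [mul_assoc]
          rw [hPP', mul_one, ← mul_assoc, hPP', one_mul]
      _ = 0 := by rw [h10]; simp
  have h := Module.End.mem_eigenspace_iff.1 (hle hX)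
  rw [hf, one_smul] at h
  calc a * X = a * X * (b * a) := by rw [hba, mul_one]
    _ = X * a := by rw [← mul_assoc, h]

/-- A connected group of positively diagonalizable matrices of determinant one acting irreducibly
is trivial. -/
theorem eq_one_of_irreducible [TopologicalSpace Γ] [PreconnectedSpace Γ] [Nonempty (Fin d)]
    (σ : Γ →* Matrix (Fin d) (Fin d) ℝ) (hσ : Continuous σ)
    (hdiag : ∀ g, ConjDiagPos (σ g)) (hdet : ∀ g, (σ g).det = 1)
    (hirr : ∀ W : Submodule ℝ (Fin d → ℝ), (∀ g, ∀ x ∈ W, σ g *ᵥ x ∈ W) → W = ⊥ ∨ W = ⊤)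
    (g : Γ) : σ g = 1 := by
  by_cases hacc : ∀ η > 0, ∃ g, σ g ≠ 1 ∧ ‖σ g - 1‖ < η
  · exfalso
    obtain ⟨X, hX0, hX⟩ := exists_isTangent_ne_zero σ hacc
    obtain ⟨v, hv0, hv⟩ := exists_common_kernel σ hdiag hdet
    have hker : ∀ w : Fin d → ℝ, ∀ Y ∈ tangentRadical σ hdiag hdet, Y *ᵥ w = 0 := by
      let W : Submodule ℝ (Fin d → ℝ) :=
        ⨅ Y ∈ tangentRadical σ hdiag hdet, LinearMap.ker (Matrix.toLin' Y)
      have hmem : ∀ w, w ∈ W ↔ ∀ Y ∈ tangentRadical σ hdiag hdet, Y *ᵥ w = 0 := by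
        intro w; simp [W, Submodule.mem_iInf]
      have hW : W = ⊤ := by
        refine (hirr W fun g x hx => ?_).resolve_left fun h => hv0 ?_
        · rw [hmem] at hx ⊢
          intro Y hY
          have h1 := hx _ (tangentRadical_conj g⁻¹ hY)
          have h2 := congrArg (σ g *ᵥ ·) h1
          simp only [inv_inv, Matrix.mulVec_mulVec, ← mul_assoc, map_mul_inv_self, one_mul,
            Matrix.mulVec_zero] at h2
          rw [Matrix.mulVec_mulVec, h2]
        · have : v ∈ W := (hmem v).2 hv
          rwa [h, Submodule.mem_bot] at this
      intro w
      exact (hmem w).1 (hW ▸ Submodule.mem_top)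
    have hrad : ∀ Y ∈ tangentSpace σ, (Y * Y).trace = 0 → Y = 0 := by
      intro Y hY hY0
      apply Matrix.toLin'.injective
      ext1 w
      ext1
      simp [hker _ Y ⟨hY, hY0⟩]
    have hcomm : ∀ g, σ g * X = X * σ g := fun g =>
      commute_of_conj_invariant (hdiag g) (map_mul_inv_self σ g) (map_inv_mul_self σ g)
        (tangentSpace σ) (fun Y hY => IsTangent.conj hY g) hrad hX
    obtain ⟨τ, hτ, -, -⟩ := tangent_spectrum hdiag hdet hX
    obtain ⟨i⟩ := ‹Nonempty (Fin d)›
    have hsing : (τ i • 1 - X).det = 0 := by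
      rw [hτ]
      exact Finset.prod_eq_zero (Finset.mem_univ i) (sub_self _)
    obtain ⟨w, hw0, hw⟩ := Matrix.exists_mulVec_eq_zero_iff.2 hsing
    have hW : LinearMap.ker (Matrix.toLin' (τ i • 1 - X)) = ⊤ := by
      refine (hirr _ fun g x hx => ?_).resolve_left fun h => hw0 ?_
      · rw [LinearMap.mem_ker, Matrix.toLin'_apply] at hx ⊢
        have : (τ i • 1 - X) * σ g = σ g * (τ i • 1 - X) := by
          rw [sub_mul, mul_sub, hcomm, smul_mul_assoc, mul_smul_comm, one_mul, mul_one]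
        rw [Matrix.mulVec_mulVec, this, ← Matrix.mulVec_mulVec, hx, Matrix.mulVec_zero]
      · have : w ∈ LinearMap.ker (Matrix.toLin' (τ i • 1 - X)) := by
          rw [LinearMap.mem_ker, Matrix.toLin'_apply, hw]
        rwa [h, Submodule.mem_bot] at this
    have hXs : X = τ i • 1 := by
      rw [LinearMap.ker_eq_top] at hW
      have := (map_eq_zero_iff _ Matrix.toLin'.injective).1 hW
      exact (sub_eq_zero.1 this).symm
    have htr := tangent_trace_eq_zero hdiag hdet hX
    rw [hXs, Matrix.trace_smul, Matrix.trace_one, Fintype.card_fin, smul_eq_mul] at htr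
    have hd : (d : ℝ) ≠ 0 := by
      have := i.pos
      positivity
    rw [(mul_eq_zero.1 htr).resolve_right hd, zero_smul] at hXs
    exact hX0 hXs
  · push Not at hacc
    obtain ⟨η, hη, h⟩ := hacc
    have hclopen : IsClopen {g | σ g = 1} := by
      refine ⟨isClosed_singleton.preimage hσ, ?_⟩
      have : {g | σ g = 1} = σ ⁻¹' Metric.ball 1 η := by
        ext g
        simp only [Set.mem_ofPred_eq, Set.mem_preimage, Metric.mem_ball, dist_eq_norm]
        refine ⟨fun hg => by simpa [hg] using hη, fun hg => ?_⟩
        by_contra hne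
        exact absurd hg (not_lt.2 (h g hne))
      rw [this]
      exact Metric.isOpen_ball.preimage hσ
    have h1 : g ∈ {g | σ g = 1} := by
      rw [hclopen.eq_univ ⟨1, map_one σ⟩]
      trivial
    exact h1

end Core

section Commutativity

open Module

lemma toMatrix_eq_conj_diagonal {V ι : Type*} [AddCommGroup V] [Module ℝ V] [Fintype ι]
    [DecidableEq ι] {f : End ℝ V} (b b' : Basis ι ℝ V) {l : ι → ℝ} (h : ∀ i, f (b' i) = l i • b' i) :
    LinearMap.toMatrix b b f = b.toMatrix b' * Matrix.diagonal l * (b.toMatrix b')⁻¹ := by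
  rw [Matrix.inv_eq_right_inv (b.toMatrix_mul_toMatrix_flip b'),
    ← basis_toMatrix_mul_linearMap_toMatrix_mul_basis_toMatrix b b' b b']
  congr 2
  ext i j
  rw [LinearMap.toMatrix_apply, h j, Matrix.diagonal_apply]
  simp only [map_smul, Basis.repr_self, Finsupp.smul_apply, smul_eq_mul, Finsupp.single_apply]
  by_cases hij : i = j
  · simp [hij]
  · simp [hij, Ne.symm hij]

lemma PosDiag.conjDiagPos_toMatrix {V : Type*} [AddCommGroup V] [Module ℝ V]
    [FiniteDimensional ℝ V] {f : End ℝ V} (hf : PosDiag f)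
    (b : Basis (Fin (finrank ℝ V)) ℝ V) : ConjDiagPos (LinearMap.toMatrix b b f) := by
  obtain ⟨b', l, hl, h⟩ := hf.exists_basis
  exact ⟨b.toMatrix b', Matrix.isUnit_det_of_right_inverse (b.toMatrix_mul_toMatrix_flip b'), l, hl,
    toMatrix_eq_conj_diagonal b b' h⟩

lemma ConjDiagPos.det_pos {d : ℕ} {a : Matrix (Fin d) (Fin d) ℝ} (ha : ConjDiagPos a) :
    0 < a.det := by
  obtain ⟨P, hP, l, hl, rfl⟩ := ha
  rw [det_conj_eq hP, Matrix.det_diagonal]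
  exact Finset.prod_pos fun i _ => hl i

lemma ConjDiagPos.smul {d : ℕ} {a : Matrix (Fin d) (Fin d) ℝ} (ha : ConjDiagPos a) {c : ℝ}
    (hc : 0 < c) : ConjDiagPos (c • a) := by
  obtain ⟨P, hP, l, hl, rfl⟩ := ha
  refine ⟨P, hP, fun i => c * l i, fun i => mul_pos hc (hl i), ?_⟩
  have : (Matrix.diagonal fun i => c * l i) = c • Matrix.diagonal l := by
    rw [← Matrix.diagonal_smul]; rfl
  rw [this, mul_smul_comm, smul_mul_assoc]

variable {Γ : Type*} [Group Γ] [TopologicalSpace Γ] [PreconnectedSpace Γ]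

/-- An irreducible connected group of positively diagonalizable endomorphisms acts by scalars. -/
lemma exists_eq_smul_one_of_irreducible {V : Type*} [AddCommGroup V] [Module ℝ V]
    [FiniteDimensional ℝ V] [Nontrivial V] (ρ : Γ →* End ℝ V)
    (hcont : ∀ v, ∀ φ : Dual ℝ V, Continuous fun g => φ (ρ g v)) (hρ : ∀ g, PosDiag (ρ g))
    (hirr : ∀ W : Submodule ℝ V, (∀ g, ∀ x ∈ W, ρ g x ∈ W) → W = ⊥ ∨ W = ⊤) (g : Γ) :
    ∃ c : ℝ, ρ g = c • 1 := by
  let b := finBasis ℝ V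
  have hd : 0 < finrank ℝ V := finrank_pos
  have hd' : (finrank ℝ V : ℝ) ≠ 0 := by positivity
  have : Nonempty (Fin (finrank ℝ V)) := ⟨⟨0, hd⟩⟩
  let M : Γ →* Matrix (Fin (finrank ℝ V)) (Fin (finrank ℝ V)) ℝ :=
    ((LinearMap.toMatrixAlgEquiv b : End ℝ V ≃ₐ[ℝ] _) : End ℝ V →* _).comp ρ
  have hM : ∀ g, M g = LinearMap.toMatrix b b (ρ g) := fun g => rfl
  have hMd : ∀ g, ConjDiagPos (M g) := fun g => (hρ g).conjDiagPos_toMatrix b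
  have hdet : ∀ g, 0 < (M g).det := fun g => (hMd g).det_pos
  have hMc : Continuous M := by
    refine continuous_matrix fun i j => ?_
    simpa [hM, LinearMap.toMatrix_apply] using hcont (b j) (b.coord i)
  let c : Γ → ℝ := fun g => (M g).det ^ (-(1 : ℝ) / finrank ℝ V)
  have hc : ∀ g, 0 < c g := fun g => Real.rpow_pos_of_pos (hdet g) _
  let σ : Γ →* Matrix (Fin (finrank ℝ V)) (Fin (finrank ℝ V)) ℝ :=
    { toFun := fun g => c g • M g
      map_one' := by simp [c]
      map_mul' := fun g h => by
        simp only [c, map_mul, Matrix.det_mul]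
        rw [Real.mul_rpow (hdet g).le (hdet h).le, smul_mul_smul_comm] }
  have hσ : ∀ g, σ g = c g • M g := fun g => rfl
  have hcc : Continuous c := (Continuous.matrix_det hMc).rpow_const fun g => Or.inl (hdet g).ne'
  have h1 : σ g = 1 := by
    refine eq_one_of_irreducible σ (hcc.smul hMc) (fun g => (hMd g).smul (hc g)) (fun g => ?_)
      (fun W hW => ?_) g
    · rw [hσ, Matrix.det_smul, Fintype.card_fin, ← Real.rpow_natCast, ← Real.rpow_mul (hdet g).le,
        div_mul_cancel₀ _ hd', Real.rpow_neg_one, inv_mul_cancel₀ (hdet g).ne']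
    · have hinv : ∀ g, ∀ x ∈ W.comap b.equivFun.toLinearMap,
          ρ g x ∈ W.comap b.equivFun.toLinearMap := by
        intro g x hx
        have h2 := W.smul_mem (c g)⁻¹ (hW g _ hx)
        rw [hσ, Matrix.smul_mulVec, smul_smul, inv_mul_cancel₀ (hc g).ne', one_smul, hM] at h2
        have h3 := LinearMap.toMatrix_mulVec_repr b b (ρ g) x
        change ⇑(b.repr (ρ g x)) ∈ W
        rw [← h3]
        exact h2
      have hsurj : Function.Surjective b.equivFun.toLinearMap := b.equivFun.surjective
      rw [← Submodule.map_comap_eq_of_surjective hsurj W]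
      rcases hirr _ hinv with h | h
      · left; rw [h, Submodule.map_bot]
      · right; rw [h, Submodule.map_top, LinearMap.range_eq_top.2 hsurj]
  refine ⟨(c g)⁻¹, (LinearMap.toMatrix b b).injective ?_⟩
  rw [← hM, map_smul, LinearMap.toMatrix_one, ← h1, hσ, smul_smul, inv_mul_cancel₀ (hc g).ne',
    one_smul]

/-- A connected group of positively diagonalizable endomorphisms is commutative. -/
theorem commute_of_posDiag (n : ℕ) : ∀ (V : Type*) [AddCommGroup V] [Module ℝ V]
    [FiniteDimensional ℝ V], finrank ℝ V = n → ∀ ρ : Γ →* End ℝ V,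
    (∀ v, ∀ φ : Dual ℝ V, Continuous fun g => φ (ρ g v)) → (∀ g, PosDiag (ρ g)) →
    ∀ g h, Commute (ρ g) (ρ h) := by
  induction n using Nat.strong_induction_on with
  | _ n ih =>
  intro V _ _ _ hn ρ hcont hρ g h
  rcases subsingleton_or_nontrivial V with hV | hV
  · exact Subsingleton.elim _ _
  by_cases hirr : ∀ W : Submodule ℝ V, (∀ g, ∀ x ∈ W, ρ g x ∈ W) → W = ⊥ ∨ W = ⊤
  · obtain ⟨c, hc⟩ := exists_eq_smul_one_of_irreducible ρ hcont hρ hirr g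
    rw [hc]
    exact (Commute.one_left _).smul_left c
  push Not at hirr
  obtain ⟨W, hW, hbot, htop⟩ := hirr
  let ρW : Γ →* End ℝ W :=
    { toFun := fun g => (ρ g).restrict (hW g)
      map_one' := by ext; simp
      map_mul' := fun g h => by ext; simp }
  let ρQ : Γ →* End ℝ (V ⧸ W) :=
    { toFun := fun g => W.mapQ W (ρ g) (hW g)
      map_one' := by ext; simp
      map_mul' := fun g h => by ext; simp }
  have hWlt : finrank ℝ W < n := hn ▸ Submodule.finrank_lt htop
  have hQlt : finrank ℝ (V ⧸ W) < n := by
    have := W.finrank_quotient_add_finrank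
    have := Submodule.one_le_finrank_iff.2 hbot
    omega
  have cW := ih _ hWlt W rfl ρW (fun v φ => by
    obtain ⟨ψ, hψ⟩ := φ.exists_extend
    have := hcont v ψ
    rw [← hψ]
    exact this) (fun g => (hρ g).restrict (hW g)) g h
  have cQ := ih _ hQlt (V ⧸ W) rfl ρQ (fun v φ => by
    obtain ⟨v, rfl⟩ := W.mkQ_surjective v
    exact hcont v (φ ∘ₗ W.mkQ)) (fun g => (hρ g).mapQ (hW g)) g h
  refine commute_of_invariant ρ hρ W g h (fun x hx => ?_) hW fun x => ?_
  · exact congrArg Subtype.val (LinearMap.congr_fun cW ⟨x, hx⟩)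
  · have := LinearMap.congr_fun cQ (W.mkQ x)
    exact (Submodule.Quotient.eq W).1 this

lemma ConjDiagPos.posDiag_toLin' {d : ℕ} {a : Matrix (Fin d) (Fin d) ℝ} (ha : ConjDiagPos a) :
    PosDiag (Matrix.toLin' a) := by
  obtain ⟨P, hP, l, hl, rfl⟩ := ha
  rw [PosDiag, eq_top_iff]
  rintro w -
  have hw : w = P *ᵥ (P⁻¹ *ᵥ w) := by
    rw [Matrix.mulVec_mulVec, Matrix.mul_nonsing_inv _ hP, Matrix.one_mulVec]
  rw [hw, Matrix.mulVec_eq_sum]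
  refine Submodule.sum_mem _ fun i _ => ?_
  rw [op_smul_eq_smul]
  refine Submodule.smul_mem _ _ (Submodule.subset_span ⟨l i, hl i, ?_⟩)
  have h1 : Pᵀ i = P *ᵥ Pi.single i 1 := (Matrix.mulVec_single_one P i).symm
  rw [h1, Matrix.toLin'_apply, Matrix.mulVec_mulVec, mul_assoc, Matrix.nonsing_inv_mul _ hP,
    mul_one, ← Matrix.mulVec_mulVec, Matrix.diagonal_mulVec_single, mul_one, ← Matrix.mulVec_smul,
    ← Pi.single_smul, smul_eq_mul, mul_one]

/-- Commuting positively diagonalizable endomorphisms have a basis of joint eigenvectors. -/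
lemma exists_joint_eigenbasis {ι V : Type*} [AddCommGroup V] [Module ℝ V] [FiniteDimensional ℝ V]
    (f : ι → End ℝ V) (hf : ∀ a, PosDiag (f a)) (hcomm : ∀ a b, Commute (f a) (f b)) :
    ∃ b : Basis (Fin (finrank ℝ V)) ℝ V, ∀ a, ∃ l : Fin (finrank ℝ V) → ℝ,
      (∀ i, 0 < l i) ∧ ∀ i, f a (b i) = l i • b i := by
  have h1 : ∀ a, ⨆ μ, (f a).maxGenEigenspace μ = ⊤ := fun a => by
    rw [eq_top_iff, ← (hf a).iSup_eigenspace]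
    exact iSup_mono fun μ => (f a).genEigenspace_le_maximal μ 1
  have h2 := End.iSup_iInf_maxGenEigenspace_eq_top_of_iSup_maxGenEigenspace_eq_top_of_commute f
    (fun a b _ => hcomm a b) h1
  have h3 : Submodule.span ℝ {v : V | ∀ a, ∃ μ : ℝ, f a v = μ • v} = ⊤ := by
    rw [eq_top_iff, ← h2]
    refine iSup_le fun χ v hv => Submodule.subset_span fun a => ⟨χ a, ?_⟩
    obtain ⟨k, hk⟩ := (End.mem_maxGenEigenspace _ _ _).1 ((Submodule.mem_iInf _).1 hv a)
    exact (hf a).eq_smul_of_pow hk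
  obtain ⟨b, hb⟩ := exists_basis_of_span_eq_top h3
  refine ⟨b, fun a => ?_⟩
  choose l hl using fun i => hb i a
  exact ⟨l, fun i => (hf a).pos_of_eigen (b.ne_zero i) (hl i), hl⟩

/-- A connected matrix group consisting of positively diagonalizable matrices is simultaneously
diagonalizable. -/
theorem exists_conj_diagonal_of_isPreconnected {n : ℕ} {A : Set (Matrix (Fin n) (Fin n) ℝ)}
    (h1 : 1 ∈ A) (hmul : ∀ a ∈ A, ∀ b ∈ A, a * b ∈ A) (hinv : ∀ a ∈ A, a⁻¹ ∈ A)
    (hconn : IsPreconnected A) (hdiag : ∀ a ∈ A, ConjDiagPos a) :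
    ∃ P : Matrix (Fin n) (Fin n) ℝ, IsUnit P.det ∧
      ∀ a ∈ A, ∃ l : Fin n → ℝ, (∀ i, 0 < l i) ∧ a = P * Matrix.diagonal l * P⁻¹ := by
  let _ : Group A :=
    { mul := fun a b => ⟨a * b, hmul a a.2 b b.2⟩
      one := ⟨1, h1⟩
      inv := fun a => ⟨(a : Matrix (Fin n) (Fin n) ℝ)⁻¹, hinv a a.2⟩
      mul_assoc := fun a b c => Subtype.ext (mul_assoc _ _ _)
      one_mul := fun a => Subtype.ext (one_mul _)
      mul_one := fun a => Subtype.ext (mul_one _)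
      inv_mul_cancel := fun a => Subtype.ext
        (Matrix.nonsing_inv_mul _ (hdiag a a.2).det_pos.ne'.isUnit) }
  have : PreconnectedSpace A := isPreconnected_iff_preconnectedSpace.1 hconn
  let ρ : A →* End ℝ (Fin n → ℝ) :=
    { toFun := fun a => Matrix.toLin' a
      map_one' := Matrix.toLin'_one
      map_mul' := fun a b => Matrix.toLin'_mul _ _ }
  have hρ : ∀ a, PosDiag (ρ a) := fun a => (hdiag a a.2).posDiag_toLin'
  have hcomm := commute_of_posDiag _ _ rfl ρ (fun v φ => by
    refine φ.continuous_of_finiteDimensional.comp ?_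
    exact Continuous.matrix_mulVec continuous_subtype_val continuous_const) hρ
  obtain ⟨b, hb⟩ := exists_joint_eigenbasis ρ hρ hcomm
  let e := finCongr (finrank_fin_fun ℝ (n := n))
  let b' := b.reindex e
  refine ⟨(Pi.basisFun ℝ (Fin n)).toMatrix b', Matrix.isUnit_det_of_right_inverse
    ((Pi.basisFun ℝ (Fin n)).toMatrix_mul_toMatrix_flip b'), fun a ha => ?_⟩
  obtain ⟨l, hl, h⟩ := hb ⟨a, ha⟩
  refine ⟨l ∘ e.symm, fun i => hl _, ?_⟩
  have h2 := toMatrix_eq_conj_diagonal (f := Matrix.toLin' a) (Pi.basisFun ℝ (Fin n)) b'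
    (l := l ∘ e.symm) (fun i => by
      simp only [b', Basis.reindex_apply, Function.comp_apply]
      exact h _)
  rw [← h2, LinearMap.toMatrix_eq_toMatrix', LinearMap.toMatrix'_toLin']

end Commutativity

section Norms

open Topology
open scoped Matrix.Norms.L2Operator

lemma mean_exp_pow_bounds {ι : Type*} [Fintype ι] {h : ℕ} (hh : 0 < h)
    (hcard : Fintype.card ι = 2 * h) {c : ℝ} (hc : c ≤ 2 * h) (y : ι → ℝ)
    (hy : ∀ j, |y j| ≤ c / (2 * h)) :
    Real.exp ((∑ j, y j) / 2) ≤ ((2 * h : ℝ)⁻¹ * ∑ j, Real.exp (y j)) ^ h ∧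
      ((2 * h : ℝ)⁻¹ * ∑ j, Real.exp (y j)) ^ h ≤
        Real.exp ((∑ j, y j) / 2 + c ^ 2 / 4 * (h : ℝ)⁻¹) := by
  have hpos : (0 : ℝ) < h := by exact_mod_cast hh
  have hcard' : ∑ _j : ι, (1 : ℝ) = 2 * h := by
    rw [Finset.sum_const, Finset.card_univ, hcard]
    simp
  set s : ℝ := (∑ j, y j) / (2 * h) with hs
  have hsum : ∑ j, y j = s * (2 * h) := by rw [hs]; field_simp
  constructor
  · have h1 : Real.exp s ≤ (2 * h : ℝ)⁻¹ * ∑ j, Real.exp (y j) := by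
      have h2 : ∑ j, Real.exp s * (1 + (y j - s)) ≤ ∑ j, Real.exp (y j) := by
        refine Finset.sum_le_sum fun j _ => ?_
        have h3 := Real.add_one_le_exp (y j - s)
        calc Real.exp s * (1 + (y j - s)) ≤ Real.exp s * Real.exp (y j - s) := by
              gcongr; linarith
          _ = Real.exp (y j) := by rw [← Real.exp_add]; ring_nf
      have h4 : ∑ j, Real.exp s * (1 + (y j - s)) = Real.exp s * (2 * h) := by
        have : ∀ j, Real.exp s * (1 + (y j - s)) =
            Real.exp s * (1 - s) * 1 + Real.exp s * y j := fun j => by ring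
        simp only [this]
        rw [Finset.sum_add_distrib, ← Finset.mul_sum, ← Finset.mul_sum, hcard', hsum]
        ring
      rw [h4] at h2
      rw [le_inv_mul_iff₀ (by positivity)]
      linarith
    calc Real.exp ((∑ j, y j) / 2) = Real.exp s ^ h := by
          rw [← Real.exp_nat_mul, hsum]; ring_nf
      _ ≤ _ := by gcongr
  · have h1 : (2 * h : ℝ)⁻¹ * ∑ j, Real.exp (y j) ≤ Real.exp (s + (c / (2 * h)) ^ 2) := by
      refine le_trans ?_ (Real.add_one_le_exp _)
      have h2 : ∑ j, Real.exp (y j) ≤ ∑ j, ((1 + (c / (2 * h)) ^ 2) * 1 + y j) := by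
        refine Finset.sum_le_sum fun j _ => ?_
        have h3 : |y j| ≤ 1 := (hy j).trans ((div_le_one (by positivity)).2 hc)
        have h4 := (abs_le.1 (Real.abs_exp_sub_one_sub_id_le h3)).2
        have h5 : y j ^ 2 ≤ (c / (2 * h)) ^ 2 := sq_le_sq' (by linarith [abs_le.1 (hy j)])
          (abs_le.1 (hy j)).2
        linarith
      rw [Finset.sum_add_distrib, ← Finset.mul_sum, hcard', hsum] at h2
      rw [inv_mul_le_iff₀ (by positivity)]
      linarith
    calc _ ≤ Real.exp (s + (c / (2 * h)) ^ 2) ^ h :=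
          pow_le_pow_left₀ (mul_nonneg (by positivity)
            (Finset.sum_nonneg fun j _ => (Real.exp_pos _).le)) h1 h
      _ = _ := by
          rw [← Real.exp_nat_mul, hsum]
          congr 1
          field_simp
          ring

variable {n : ℕ}

lemma eigenvalue_le_norm {P : Matrix (Fin n) (Fin n) ℝ} (hP : IsUnit P.det) (l : Fin n → ℝ)
    (i : Fin n) : l i ≤ ‖P * Matrix.diagonal l * P⁻¹‖ := by
  set v : Fin n → ℝ := P *ᵥ Pi.single i 1 with hv
  have hev : (P * Matrix.diagonal l * P⁻¹) *ᵥ v = l i • v := by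
    rw [hv, Matrix.mulVec_mulVec, mul_assoc, Matrix.nonsing_inv_mul _ hP,
      mul_one, ← Matrix.mulVec_mulVec, Matrix.diagonal_mulVec_single, mul_one, ← Matrix.mulVec_smul,
      ← Pi.single_smul, smul_eq_mul, mul_one]
  have hv0 : v ≠ 0 := by
    intro h0
    have h1 : P⁻¹ *ᵥ v = Pi.single i 1 := by
      rw [hv, Matrix.mulVec_mulVec, Matrix.nonsing_inv_mul _ hP, Matrix.one_mulVec]
    rw [h0, Matrix.mulVec_zero] at h1
    have := congrFun h1 i
    simp at this
  have h1 := Matrix.l2_opNorm_mulVec (P * Matrix.diagonal l * P⁻¹) (WithLp.toLp 2 v)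
  rw [WithLp.ofLp_toLp, hev, map_smul, norm_smul] at h1
  have h2 : 0 < ‖WithLp.toLp 2 v‖ := norm_pos_iff.2 fun h => hv0 (by simpa using h)
  exact (le_abs_self _).trans (le_of_mul_le_mul_right h1 h2)

lemma abs_le_of_sum_eq_zero {y : Fin n → ℝ} {q : ℝ} (h0 : ∑ i, y i = 0) (h : ∀ i, y i ≤ q)
    (i : Fin n) : |y i| ≤ n * q := by
  have hn : (1 : ℝ) ≤ n := by exact_mod_cast i.pos
  have h1 : 0 ≤ n * q := by
    calc 0 = ∑ i, y i := h0.symm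
      _ ≤ ∑ _i : Fin n, q := Finset.sum_le_sum fun i _ => h i
      _ = n * q := by simp
  have hq : 0 ≤ q := nonneg_of_mul_nonneg_right h1 (by linarith)
  refine abs_le.2 ⟨?_, (h i).trans (by nlinarith)⟩
  have h2 : ∑ j ∈ Finset.univ.erase i, y j ≤ ∑ _j ∈ Finset.univ.erase i, q :=
    Finset.sum_le_sum fun j _ => h j
  have h3 := Finset.add_sum_erase Finset.univ y (Finset.mem_univ i)
  rw [Finset.sum_const, nsmul_eq_mul, Finset.card_erase_of_mem (Finset.mem_univ i),
    Finset.card_univ, Fintype.card_fin, Nat.cast_sub i.pos, Nat.cast_one] at h2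
  linarith

/-- The matrix with eigenvalues `exp (x i)` in the frame `P`. -/
def conjExp (P : Matrix (Fin n) (Fin n) ℝ) (x : Fin n → ℝ) : Matrix (Fin n) (Fin n) ℝ :=
  P * Matrix.diagonal (fun i => Real.exp (x i)) * P⁻¹

lemma conj_diagonal_mul {P : Matrix (Fin n) (Fin n) ℝ} (hP : IsUnit P.det) (x y : Fin n → ℝ) :
    P * Matrix.diagonal x * P⁻¹ * (P * Matrix.diagonal y * P⁻¹) =
      P * Matrix.diagonal (fun i => x i * y i) * P⁻¹ := by
  rw [← Matrix.diagonal_mul_diagonal]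
  simp only [mul_assoc]
  rw [← mul_assoc P⁻¹ P, Matrix.nonsing_inv_mul _ hP, one_mul]

lemma conj_diagonal_pow {P : Matrix (Fin n) (Fin n) ℝ} (hP : IsUnit P.det) (x : Fin n → ℝ)
    (k : ℕ) : (P * Matrix.diagonal x * P⁻¹) ^ k = P * Matrix.diagonal (fun i => x i ^ k) * P⁻¹ := by
  induction k with
  | zero => simp [Matrix.mul_nonsing_inv _ hP]
  | succ k ih => simp only [pow_succ, ih, conj_diagonal_mul hP]

lemma conjExp_add {P : Matrix (Fin n) (Fin n) ℝ} (hP : IsUnit P.det) (x y : Fin n → ℝ) :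
    conjExp P (x + y) = conjExp P x * conjExp P y := by
  rw [conjExp, conjExp, conjExp, conj_diagonal_mul hP]
  simp [Real.exp_add]

lemma conjExp_injective {P : Matrix (Fin n) (Fin n) ℝ} (hP : IsUnit P.det) :
    Function.Injective (conjExp P) := by
  intro x y h
  have h1 := congrArg (fun M => P⁻¹ * M * P) h
  simp only [conjExp, mul_assoc, Matrix.nonsing_inv_mul _ hP, mul_one] at h1
  rw [← mul_assoc, ← mul_assoc, Matrix.nonsing_inv_mul _ hP, one_mul, one_mul] at h1
  ext i
  exact Real.exp_injective (congrFun (Matrix.diagonal_injective h1) i)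

/-- If the norm can be halved multiplicatively inside a set of simultaneously diagonalizable
matrices, it can be divided evenly among `2 ^ k` factors. -/
lemma exists_equidistributed_factors {P : Matrix (Fin n) (Fin n) ℝ} {S : Set (Fin n → ℝ)}
    (hS : ∀ x ∈ S, ∃ y ∈ S, ∃ z ∈ S, x = y + z ∧
      ‖conjExp P y‖ = ‖conjExp P x‖ ^ (1 / 2 : ℝ) ∧ ‖conjExp P z‖ = ‖conjExp P x‖ ^ (1 / 2 : ℝ))
    (k : ℕ) : ∀ x ∈ S, ∃ (ι : Type) (_ : Fintype ι) (z : ι → Fin n → ℝ),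
      Fintype.card ι = 2 ^ k ∧ ∑ j, z j = x ∧ ∀ j, z j ∈ S ∧
        ‖conjExp P (z j)‖ = ‖conjExp P x‖ ^ ((1 / 2 : ℝ) ^ k) := by
  induction k with
  | zero => exact fun x hx => ⟨Unit, inferInstance, fun _ => x, by simp, by simp, by simp [hx]⟩
  | succ k ih =>
    intro x hx
    obtain ⟨y, hy, z, hz, rfl, hny, hnz⟩ := hS x hx
    obtain ⟨ι, _, u, hu1, hu2, hu3⟩ := ih y hy
    obtain ⟨ι', _, v, hv1, hv2, hv3⟩ := ih z hz
    refine ⟨ι ⊕ ι', inferInstance, Sum.elim u v, ?_, ?_, ?_⟩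
    · rw [Fintype.card_sum, hu1, hv1]; ring
    · simp [Fintype.sum_sum_type, hu2, hv2]
    · have hpow : ‖conjExp P (y + z)‖ ^ ((1 / 2 : ℝ) ^ (k + 1)) =
          (‖conjExp P (y + z)‖ ^ (1 / 2 : ℝ)) ^ ((1 / 2 : ℝ) ^ k) := by
        rw [← Real.rpow_mul (norm_nonneg _)]; ring_nf
      rintro (j | j)
      · exact ⟨(hu3 j).1, by rw [hpow, ← hny]; exact (hu3 j).2⟩
      · exact ⟨(hv3 j).1, by rw [hpow, ← hnz]; exact (hv3 j).2⟩

/-- Averaging equidistributed factors bounds the norm of the square root. -/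
lemma norm_conjExp_half_le {P : Matrix (Fin n) (Fin n) ℝ} (hP : IsUnit P.det)
    {S : Set (Fin n → ℝ)} (h0 : ∀ x ∈ S, ∑ i, x i = 0)
    (hS : ∀ x ∈ S, ∃ y ∈ S, ∃ z ∈ S, x = y + z ∧
      ‖conjExp P y‖ = ‖conjExp P x‖ ^ (1 / 2 : ℝ) ∧ ‖conjExp P z‖ = ‖conjExp P x‖ ^ (1 / 2 : ℝ))
    {x : Fin n → ℝ} (hx : x ∈ S) :
    ‖conjExp P (fun i => x i / 2)‖ ≤ ‖conjExp P x‖ ^ (1 / 2 : ℝ) := by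
  rcases isEmpty_or_nonempty (Fin n) with hn | ⟨⟨i₀⟩⟩
  · rw [Subsingleton.elim (conjExp P fun i => x i / 2) 0, norm_zero]
    positivity
  have hrpos : ∀ y, 0 < ‖conjExp P y‖ := fun y =>
    (Real.exp_pos _).trans_le (eigenvalue_le_norm hP (fun i => Real.exp (y i)) i₀)
  set r := ‖conjExp P x‖ with hr
  set c : ℝ := n * Real.log r with hc
  choose ι inst z hcard hsum hz using fun k => exists_equidistributed_factors hS k x hx
  let ω : ℕ → Fin n → ℝ := fun k i =>
    (2 * (2 ^ k : ℕ) : ℝ)⁻¹ * ∑ j : ι (k + 1), Real.exp (z (k + 1) j i)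
  have hbound : ∀ k j i, |z k j i| ≤ c / 2 ^ k := by
    intro k j i
    have h1 : ∀ i, z k j i ≤ Real.log r / 2 ^ k := fun i => by
      have h2 := eigenvalue_le_norm hP (fun i => Real.exp (z k j i)) i
      have h3 := (hz k j).2
      rw [conjExp] at h3
      rw [h3, ← Real.le_log_iff_exp_le (Real.rpow_pos_of_pos (hrpos x) _),
        Real.log_rpow (hrpos x)] at h2
      refine h2.trans (le_of_eq ?_)
      rw [one_div, inv_pow]
      field_simp
      rw [hr]
    refine (abs_le_of_sum_eq_zero (h0 _ (hz k j).1) h1 i).trans (le_of_eq ?_)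
    rw [hc]; ring
  have hpow2 : Tendsto (fun k : ℕ => ((2 ^ k : ℕ) : ℝ)) atTop atTop :=
    tendsto_natCast_atTop_atTop.comp (tendsto_pow_atTop_atTop_of_one_lt one_lt_two)
  have hω : Tendsto (fun k i => ω k i ^ (2 ^ k)) atTop (𝓝 fun i => Real.exp (x i / 2)) := by
    refine tendsto_pi_nhds.2 fun i => ?_
    have hsumi : ∀ k, ∑ j, z k j i = x i := fun k => by rw [← hsum k, Finset.sum_apply]
    have hev : ∀ᶠ k : ℕ in atTop, Real.exp (x i / 2) ≤ ω k i ^ (2 ^ k) ∧ ω k i ^ (2 ^ k) ≤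
        Real.exp (x i / 2 + c ^ 2 / 4 * ((2 ^ k : ℕ) : ℝ)⁻¹) := by
      filter_upwards [hpow2.eventually_ge_atTop c] with k hk
      have := mean_exp_pow_bounds (h := 2 ^ k) (by positivity) (by rw [hcard, pow_succ']) (c := c)
        (by linarith [Nat.cast_nonneg (α := ℝ) (2 ^ k)]) (fun j => z (k + 1) j i) (fun j => by
          refine (hbound _ j i).trans (le_of_eq ?_)
          push_cast
          rw [pow_succ'])
      rwa [hsumi] at this
    refine tendsto_of_tendsto_of_tendsto_of_le_of_le' tendsto_const_nhds ?_
      (hev.mono fun k h => h.1) (hev.mono fun k h => h.2)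
    refine (Real.continuous_exp.tendsto _).comp ?_
    simpa using ((tendsto_inv_atTop_zero.comp hpow2).const_mul (c ^ 2 / 4)).const_add (x i / 2)
  have hcont : Continuous fun l : Fin n → ℝ => ‖P * Matrix.diagonal l * P⁻¹‖ := by fun_prop
  refine le_of_tendsto ((hcont.tendsto _).comp hω) (Eventually.of_forall fun k => ?_)
  change ‖P * Matrix.diagonal (fun i => ω k i ^ (2 ^ k)) * P⁻¹‖ ≤ _
  rw [← conj_diagonal_pow hP]
  refine (norm_pow_le' _ (by positivity)).trans ?_
  have h1 : ‖P * Matrix.diagonal (ω k) * P⁻¹‖ ≤ r ^ ((1 / 2 : ℝ) ^ (k + 1)) := by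
    have h2 : P * Matrix.diagonal (ω k) * P⁻¹ =
        (2 * (2 ^ k : ℕ) : ℝ)⁻¹ • ∑ j, conjExp P (z (k + 1) j) := by
      simp only [conjExp]
      rw [← Finset.sum_mul, ← Finset.mul_sum, ← smul_mul_assoc, ← mul_smul_comm]
      congr 2
      ext a b
      simp only [ω, Matrix.smul_apply, Matrix.sum_apply, Matrix.diagonal_apply, smul_eq_mul]
      split_ifs <;> simp
    rw [h2, norm_smul, Real.norm_of_nonneg (by positivity), inv_mul_le_iff₀ (by positivity)]
    refine (norm_sum_le _ _).trans (le_of_eq ?_)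
    simp only [(hz (k + 1) _).2]
    rw [Finset.sum_const, Finset.card_univ, hcard, nsmul_eq_mul, pow_succ']
    push_cast
    ring
  calc _ ≤ (r ^ ((1 / 2 : ℝ) ^ (k + 1))) ^ (2 ^ k) := by gcongr
    _ = r ^ (1 / 2 : ℝ) := by
      rw [← Real.rpow_natCast, ← Real.rpow_mul (norm_nonneg _)]
      congr 1
      push_cast
      rw [pow_succ', mul_assoc, ← mul_pow]
      norm_num

end Norms

section Duality

open Topology
open scoped Matrix.Norms.L2Operator

variable {n : ℕ}

lemma sq_norm_le_norm_mul_self {P : Matrix (Fin n) (Fin n) ℝ} (hP : IsUnit P.det)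
    {A : Set (Matrix (Fin n) (Fin n) ℝ)} (hmul : ∀ a ∈ A, ∀ b ∈ A, a * b ∈ A)
    (hdet : ∀ a ∈ A, a.det = 1)
    (hdiag : ∀ a ∈ A, ∃ l : Fin n → ℝ, (∀ i, 0 < l i) ∧ a = P * Matrix.diagonal l * P⁻¹)
    (hhalf : ∀ a ∈ A, ∃ b ∈ A, ∃ c ∈ A, a = b * c ∧
      ‖b‖ = ‖a‖ ^ (1 / 2 : ℝ) ∧ ‖c‖ = ‖a‖ ^ (1 / 2 : ℝ))
    {a : Matrix (Fin n) (Fin n) ℝ} (ha : a ∈ A) : ‖a‖ ^ 2 ≤ ‖a * a‖ := by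
  have hlog : ∀ a ∈ A, ∃ x, conjExp P x = a := fun a ha => by
    obtain ⟨l, hl, h⟩ := hdiag a ha
    refine ⟨fun i => Real.log (l i), ?_⟩
    simp only [conjExp, Real.exp_log (hl _)]
    exact h.symm
  let S : Set (Fin n → ℝ) := {x | conjExp P x ∈ A}
  have h0 : ∀ x ∈ S, ∑ i, x i = 0 := fun x hx => by
    have h1 := hdet _ hx
    rw [conjExp, det_conj_eq hP, Matrix.det_diagonal, ← Real.exp_sum] at h1
    exact Real.exp_eq_one_iff _ |>.1 h1
  have hS : ∀ x ∈ S, ∃ y ∈ S, ∃ z ∈ S, x = y + z ∧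
      ‖conjExp P y‖ = ‖conjExp P x‖ ^ (1 / 2 : ℝ) ∧
      ‖conjExp P z‖ = ‖conjExp P x‖ ^ (1 / 2 : ℝ) := fun x hx => by
    obtain ⟨b, hb, c, hc, h1, h2, h3⟩ := hhalf _ hx
    obtain ⟨y, rfl⟩ := hlog b hb
    obtain ⟨z, rfl⟩ := hlog c hc
    refine ⟨y, hb, z, hc, conjExp_injective hP ?_, h2, h3⟩
    rw [h1, conjExp_add hP]
  obtain ⟨x, rfl⟩ := hlog a ha
  have h1 : conjExp P (x + x) ∈ A := by
    rw [conjExp_add hP]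
    exact hmul _ ha _ ha
  have h2 := norm_conjExp_half_le hP h0 hS h1
  rw [conjExp_add hP] at h2
  have h3 : (fun i => (x + x) i / 2) = x := by
    ext i
    simp
  rw [h3] at h2
  calc ‖conjExp P x‖ ^ 2 ≤ (‖conjExp P x * conjExp P x‖ ^ (1 / 2 : ℝ)) ^ 2 := by gcongr
    _ = _ := by
      rw [← Real.rpow_natCast, ← Real.rpow_mul (norm_nonneg _)]
      norm_num

lemma le_of_pow_two_pow_le {x y κ : ℝ} (hy : 0 ≤ y)
    (h : ∀ k : ℕ, x ^ (2 ^ k) ≤ κ * y ^ (2 ^ k)) : x ≤ y := by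
  by_contra! hlt
  rcases hy.eq_or_lt with rfl | hy
  · have := h 0
    simp at this
    linarith
  have h1 : 1 < x / y := (one_lt_div hy).2 hlt
  have h2 : Tendsto (fun k : ℕ => (x / y) ^ (2 ^ k)) atTop atTop :=
    (tendsto_pow_atTop_atTop_of_one_lt h1).comp (tendsto_pow_atTop_atTop_of_one_lt one_lt_two)
  obtain ⟨k, hk⟩ := (h2.eventually_gt_atTop κ).exists
  rw [div_pow, lt_div_iff₀ (by positivity)] at hk
  exact absurd (h k) (not_le.2 hk)

lemma eq_zero_of_isSymm_of_quadratic {M : Matrix (Fin n) (Fin n) ℝ} (hM : M.IsSymm)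
    (h : ∀ v, v ⬝ᵥ M *ᵥ v = 0) : M = 0 := by
  have hs : ∀ u v, u ⬝ᵥ M *ᵥ v = v ⬝ᵥ M *ᵥ u := fun u v => by
    rw [Matrix.dotProduct_mulVec, ← Matrix.mulVec_transpose, hM.eq, dotProduct_comm]
  have h2 : ∀ u v, u ⬝ᵥ M *ᵥ v = 0 := fun u v => by
    have h3 := h (u + v)
    rw [Matrix.mulVec_add, add_dotProduct, dotProduct_add, dotProduct_add, h u, h v, hs v u] at h3
    linarith
  ext i j
  have := h2 (Pi.single i 1) (Pi.single j 1)
  simpa using this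

lemma SOset.mul_mul_transpose {Q : (Fin n → ℝ) → ℝ} {J : Matrix (Fin n) (Fin n) ℝ}
    (hJ : J.IsSymm) (hQ : ∀ v, Q v = v ⬝ᵥ J *ᵥ v) {g : Matrix (Fin n) (Fin n) ℝ}
    (hg : g ∈ SOset Q) : g * J * gᵀ = J := by
  refine sub_eq_zero.1 (eq_zero_of_isSymm_of_quadratic ?_ fun v => ?_)
  · rw [Matrix.IsSymm, Matrix.transpose_sub, Matrix.transpose_mul, Matrix.transpose_mul,
      Matrix.transpose_transpose, hJ.eq, mul_assoc]
  · have h1 := hg.2 v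
    rw [hQ, hQ] at h1
    rw [Matrix.sub_mulVec, dotProduct_sub, sub_eq_zero, ← h1, ← Matrix.mulVec_mulVec,
      ← Matrix.mulVec_mulVec, Matrix.mulVec_transpose, Matrix.dotProduct_mulVec]

/-- On an orthogonal group the norms of `g` and `g⁻¹` are comparable. -/
lemma SOset.norm_le {Q : (Fin n → ℝ) → ℝ} {J : Matrix (Fin n) (Fin n) ℝ}
    (hJ : J.IsSymm) (hJdet : IsUnit J.det) (hQ : ∀ v, Q v = v ⬝ᵥ J *ᵥ v)
    {g : Matrix (Fin n) (Fin n) ℝ} (hg : g ∈ SOset Q) : ‖g‖ ≤ ‖J‖ * ‖J⁻¹‖ * ‖g⁻¹‖ := by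
  have hgdet : IsUnit g.det := by rw [hg.1]; exact isUnit_one
  have h1 : g * J = J * g⁻¹ᵀ := by
    have h2 := congrArg (· * g⁻¹ᵀ) (SOset.mul_mul_transpose hJ hQ hg)
    simp only [mul_assoc] at h2
    rwa [← Matrix.transpose_mul, Matrix.nonsing_inv_mul _ hgdet, Matrix.transpose_one,
      mul_one] at h2
  have h2 : g = J * g⁻¹ᵀ * J⁻¹ := by
    rw [← h1, mul_assoc, Matrix.mul_nonsing_inv _ hJdet, mul_one]
  have h3 : ‖g⁻¹ᵀ‖ = ‖g⁻¹‖ := by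
    rw [← Matrix.conjTranspose_eq_transpose_of_trivial, Matrix.l2_opNorm_conjTranspose]
  calc ‖g‖ = ‖J * g⁻¹ᵀ * J⁻¹‖ := by rw [← h2]
    _ ≤ ‖J‖ * ‖g⁻¹ᵀ‖ * ‖J⁻¹‖ := norm_mul₃_le
    _ = _ := by rw [h3]; ring

lemma norm_le_norm_inv {Q : (Fin n → ℝ) → ℝ} (hQ : IsNondegQuadForm Q)
    {A : Set (Matrix (Fin n) (Fin n) ℝ)} (hA : A ⊆ SOset Q)
    (hmul : ∀ a ∈ A, ∀ b ∈ A, a * b ∈ A) (hsq : ∀ a ∈ A, ‖a‖ ^ 2 ≤ ‖a * a‖)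
    {a : Matrix (Fin n) (Fin n) ℝ} (ha : a ∈ A) : ‖a‖ ≤ ‖a⁻¹‖ := by
  obtain ⟨J, hJ, hJdet, hQJ⟩ := hQ
  refine le_of_pow_two_pow_le (κ := ‖J‖ * ‖J⁻¹‖) (norm_nonneg _) fun k => ?_
  have h1 : a ^ (2 ^ k) ∈ A ∧ ‖a‖ ^ (2 ^ k) ≤ ‖a ^ (2 ^ k)‖ := by
    induction k with
    | zero => simpa using ha
    | succ k ih =>
      rw [pow_succ, pow_mul, pow_mul, pow_two (a ^ 2 ^ k)]
      exact ⟨hmul _ ih.1 _ ih.1, (by gcongr; exact ih.2 : _ ≤ ‖a ^ 2 ^ k‖ ^ 2).trans (hsq _ ih.1)⟩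
  calc ‖a‖ ^ (2 ^ k) ≤ ‖a ^ (2 ^ k)‖ := h1.2
    _ ≤ ‖J‖ * ‖J⁻¹‖ * ‖(a ^ (2 ^ k))⁻¹‖ := SOset.norm_le hJ hJdet hQJ (hA h1.1)
    _ ≤ _ := by
      rw [← Matrix.inv_pow']
      gcongr
      exact norm_pow_le' _ (by positivity)

lemma opNorm_eq_norm (g : Matrix (Fin n) (Fin n) ℝ) : opNorm g = ‖g‖ := rfl

lemma mnorm_eq_norm_inv (g : Matrix (Fin n) (Fin n) ℝ) : mnorm g = ‖g⁻¹‖ := opNorm_eq_norm _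

lemma mnorm_nonneg (g : Matrix (Fin n) (Fin n) ℝ) : 0 ≤ mnorm g := by
  rw [mnorm_eq_norm_inv]
  exact norm_nonneg _

lemma mnorm_one_pos [Nonempty (Fin n)] : 0 < mnorm (1 : Matrix (Fin n) (Fin n) ℝ) := by
  rw [mnorm_eq_norm_inv, inv_one]
  exact norm_pos_iff.2 one_ne_zero

lemma mnorm_mul_le (g h : Matrix (Fin n) (Fin n) ℝ) : mnorm (g * h) ≤ mnorm g * mnorm h := by
  rw [mnorm_eq_norm_inv, Matrix.mul_inv_rev, mnorm_eq_norm_inv, mnorm_eq_norm_inv, mul_comm ‖g⁻¹‖]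
  exact norm_mul_le _ _

lemma mnorm_mul_mul_le {x y z : Matrix (Fin n) (Fin n) ℝ} {p q r : ℝ} (hx : mnorm x ≤ p)
    (hy : mnorm y ≤ q) (hz : mnorm z ≤ r) : mnorm (x * y * z) ≤ p * q * r := by
  have hp := (mnorm_nonneg x).trans hx
  have hq := (mnorm_nonneg y).trans hy
  refine (mnorm_mul_le _ _).trans (mul_le_mul ((mnorm_mul_le _ _).trans ?_) hz (mnorm_nonneg z)
    (mul_nonneg hp hq))
  exact mul_le_mul hx hy (mnorm_nonneg y) hp

lemma one_mem_SOset (Q : (Fin n → ℝ) → ℝ) : 1 ∈ SOset Q :=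
  ⟨Matrix.det_one, fun v => by rw [Matrix.vecMul_one]⟩

lemma SOset_mul_mem {Q : (Fin n → ℝ) → ℝ} {g h : Matrix (Fin n) (Fin n) ℝ} (hg : g ∈ SOset Q)
    (hh : h ∈ SOset Q) : g * h ∈ SOset Q :=
  ⟨by rw [Matrix.det_mul, hg.1, hh.1, one_mul], fun v => by
    rw [← Matrix.vecMul_vecMul, hh.2, hg.2]⟩

lemma SOplus_subset (Q : (Fin n → ℝ) → ℝ) : SOplus Q ⊆ SOset Q := connectedComponentIn_subset _ _

lemma SOplus_mul_mem {Q : (Fin n → ℝ) → ℝ} {g h : Matrix (Fin n) (Fin n) ℝ} (hg : g ∈ SOplus Q)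
    (hh : h ∈ SOplus Q) : g * h ∈ SOplus Q := by
  have h1 : IsPreconnected ((g * ·) '' SOplus Q) :=
    isPreconnected_connectedComponentIn.image _ (continuous_const.mul continuous_id).continuousOn
  have h2 := h1.subset_connectedComponentIn
    (⟨1, mem_connectedComponentIn (one_mem_SOset Q), mul_one g⟩ : g ∈ (g * ·) '' SOplus Q)
    (by rintro _ ⟨x, hx, rfl⟩; exact SOset_mul_mem (SOplus_subset Q hg) (SOplus_subset Q hx))
  rw [← connectedComponentIn_eq hg] at h2
  exact h2 ⟨h, hh, rfl⟩

/-- Balls of radius larger than one have positive Haar measure. -/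
lemma IsHaarOn.ball_pos {Q : (Fin n → ℝ) → ℝ} {μ : Measure (Matrix (Fin n) (Fin n) ℝ)}
    (hμ : IsHaarOn (SOplus Q) μ) : 0 < μ (GballQ Q 2) := by
  let U : Set (Matrix (Fin n) (Fin n) ℝ) := {g | ‖g.adjugate‖ < 2}
  have hU : IsOpen U := isOpen_lt (Continuous.matrix_adjugate continuous_id).norm continuous_const
  have h1 : (1 : Matrix (Fin n) (Fin n) ℝ) ∈ U := by
    change ‖(1 : Matrix (Fin n) (Fin n) ℝ).adjugate‖ < 2
    rw [Matrix.adjugate_one]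
    rcases subsingleton_or_nontrivial (Matrix (Fin n) (Fin n) ℝ) with h | h
    · rw [Subsingleton.elim (1 : Matrix (Fin n) (Fin n) ℝ) 0, norm_zero]
      exact two_pos
    · rw [CStarRing.norm_one]
      exact one_lt_two
  have hpos := hμ.open_pos U hU ⟨1, h1, mem_connectedComponentIn (one_mem_SOset Q)⟩
  have hle : U ⊆ GballQ Q 2 ∪ (SOplus Q)ᶜ := fun g hg => by
    by_cases hgG : g ∈ SOplus Q
    · refine Or.inl ⟨hgG, ?_⟩
      change mnorm g ≤ 2
      rw [mnorm_eq_norm_inv, Matrix.inv_def, (SOplus_subset Q hgG).1, Ring.inverse_one, one_smul]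
      exact le_of_lt hg
    · exact Or.inr hgG
  calc 0 < μ U := hpos
    _ ≤ μ (GballQ Q 2) + μ (SOplus Q)ᶜ := (measure_mono hle).trans (measure_union_le _ _)
    _ = _ := by rw [hμ.compl, add_zero]

/-- Translating a set into another one by an element of the group. -/
lemma IsHaarOn.le_of_mul_mem {G : Set (Matrix (Fin n) (Fin n) ℝ)}
    {μ : Measure (Matrix (Fin n) (Fin n) ℝ)} (hμ : IsHaarOn G μ)
    {g : Matrix (Fin n) (Fin n) ℝ} (hg : g ∈ G) {S T : Set (Matrix (Fin n) (Fin n) ℝ)}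
    (h : ∀ x ∈ S, g * x ∈ T) : μ S ≤ μ T := by
  calc μ S ≤ μ ((g * ·) ⁻¹' toMeasurable μ T) :=
        measure_mono fun x hx => subset_toMeasurable μ T (h x hx)
    _ = μ (toMeasurable μ T) := hμ.left_inv g hg _ (measurableSet_toMeasurable μ T)
    _ = μ T := measure_toMeasurable T

end Duality

/-- **Lemma 5.2**: for `G = KAK` with `K` a maximal compact subgroup of norm bound `C` and
`A` a Cartan subgroup (consisting of matrices diagonalizable over `ℝ` with positive
eigenvalues and with `‖a^s‖ = ‖a‖^s` along the chamber), one has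
`m_G(γG_t ∩ G_t) ≥ m_G(G₂) > 0` uniformly for all `t > 2C²` and all `γ ∈ G` with
`‖γ‖ ≤ t²/(4C⁴)`. -/
theorem haar_intersection_lower_bound
    {n p q : ℕ} (hq : 1 ≤ q) (hpq : q ≤ p) (hn3 : 3 ≤ n)
    (Q : (Fin n → ℝ) → ℝ) (hQ : IsNondegQuadForm Q) (hsig : HasSignature Q p q)
    (μG : Measure (Matrix (Fin n) (Fin n) ℝ)) (hμG : IsHaarOn (SOplus Q) μG)
    (K A : Set (Matrix (Fin n) (Fin n) ℝ))
    (hKsub : K ⊆ SOplus Q) (hKcpt : IsCompact K)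
    (hK1 : (1 : Matrix (Fin n) (Fin n) ℝ) ∈ K)
    (hKmul : ∀ k₁ ∈ K, ∀ k₂ ∈ K, k₁ * k₂ ∈ K) (hKinv : ∀ k ∈ K, k⁻¹ ∈ K)
    (hAsub : A ⊆ SOplus Q) (hA1 : (1 : Matrix (Fin n) (Fin n) ℝ) ∈ A)
    (hAmul : ∀ a₁ ∈ A, ∀ a₂ ∈ A, a₁ * a₂ ∈ A) (hAinv : ∀ a ∈ A, a⁻¹ ∈ A)
    (hAconn : IsConnected A)
    (hAdiag : ∀ a ∈ A, ∃ P : Matrix (Fin n) (Fin n) ℝ, IsUnit P.det ∧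
      ∃ d : Fin n → ℝ, (∀ i, 0 < d i) ∧ a = P * Matrix.diagonal d * P⁻¹)
    (hAinterp : ∀ a ∈ A, ∀ s : ℝ, s ∈ Set.Icc (0 : ℝ) 1 →
      ∃ b ∈ A, ∃ c ∈ A, a = b * c ∧ mnorm b = mnorm a ^ s ∧ mnorm c = mnorm a ^ (1 - s))
    (hKAK : ∀ g ∈ SOplus Q, ∃ k₁ ∈ K, ∃ a ∈ A, ∃ k₂ ∈ K, g = k₁ * a * k₂)
    (C : ℝ) (hC : ∀ k ∈ K, mnorm k ≤ C) :
    0 < μG (GballQ Q 2) ∧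
    ∀ t : ℝ, 2 * C ^ 2 < t → ∀ γ ∈ SOplus Q, mnorm γ ≤ t ^ 2 / (4 * C ^ 4) →
      μG (GballQ Q 2) ≤ μG ((fun x => γ * x) '' GballQ Q t ∩ GballQ Q t) := by
  obtain ⟨P, hP, hPA⟩ := exists_conj_diagonal_of_isPreconnected hA1 hAmul hAinv
    hAconn.isPreconnected hAdiag
  have hAso : A ⊆ SOset Q := hAsub.trans (SOplus_subset Q)
  have hunit : ∀ {g : Matrix (Fin n) (Fin n) ℝ}, g ∈ SOset Q → IsUnit g.det := fun hg => by
    rw [hg.1]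
    exact isUnit_one
  have hhalf : ∀ a ∈ A, ∃ b ∈ A, ∃ c ∈ A, a = b * c ∧ mnorm b = mnorm a ^ (1 / 2 : ℝ) ∧
      mnorm c = mnorm a ^ (1 / 2 : ℝ) := fun a ha => by
    obtain ⟨b, hb, c, hc, h1, h2, h3⟩ := hAinterp a ha (1 / 2) (by norm_num)
    exact ⟨b, hb, c, hc, h1, h2, by rw [h3]; norm_num⟩
  have hsq := fun a (ha : a ∈ A) => sq_norm_le_norm_mul_self hP hAmul (fun a ha => (hAso ha).1) hPA
    (fun a ha => by
      obtain ⟨b, hb, c, hc, h1, h2, h3⟩ := hhalf _ (hAinv a ha)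
      simp only [mnorm_eq_norm_inv, Matrix.nonsing_inv_nonsing_inv _ (hunit (hAso ha))] at h2 h3
      refine ⟨c⁻¹, hAinv c hc, b⁻¹, hAinv b hb, ?_, h3, h2⟩
      rw [← Matrix.mul_inv_rev, ← h1, Matrix.nonsing_inv_nonsing_inv _ (hunit (hAso ha))]) ha
  refine ⟨hμG.ball_pos, fun t ht γ hγ hγt => ?_⟩
  have hCpos : 0 < C := by
    have : Nonempty (Fin n) := ⟨⟨0, by omega⟩⟩
    exact mnorm_one_pos.trans_le (hC 1 hK1)
  have ht0 : 0 < t := lt_of_le_of_lt (by positivity) ht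
  obtain ⟨k₁, hk₁, a, ha, k₂, hk₂, rfl⟩ := hKAK γ hγ
  have hu₁ := hunit (SOplus_subset Q (hKsub hk₁))
  have hu₂ := hunit (SOplus_subset Q (hKsub hk₂))
  have hanorm : mnorm a ≤ (t / (2 * C)) ^ 2 := by
    have h1 := mnorm_mul_mul_le (hC _ (hKinv _ hk₁)) hγt (hC _ (hKinv _ hk₂))
    have h2 : k₁⁻¹ * (k₁ * a * k₂) * k₂⁻¹ = a := by
      rw [mul_assoc k₁, Matrix.nonsing_inv_mul_cancel_left _ _ hu₁,
        Matrix.mul_nonsing_inv_cancel_right _ _ hu₂]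
    rw [h2] at h1
    refine h1.trans (le_of_eq ?_)
    field_simp
    ring
  obtain ⟨b, hb, c, hc, rfl, hbn, hcn⟩ := hhalf a ha
  have huc := hunit (hAso hc)
  have hroot : mnorm (b * c) ^ (1 / 2 : ℝ) ≤ t / (2 * C) := by
    rw [← Real.sqrt_eq_rpow]
    exact (Real.sqrt_le_left (by positivity)).2 hanorm
  have hcinv : mnorm c⁻¹ ≤ t / (2 * C) := by
    refine le_trans ?_ (hcn.le.trans hroot)
    rw [mnorm_eq_norm_inv, mnorm_eq_norm_inv, Matrix.nonsing_inv_nonsing_inv _ huc]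
    exact norm_le_norm_inv hQ hAso hAmul hsq hc
  have hbound : C * (t / (2 * C)) * 2 = t := by field_simp
  refine hμG.le_of_mul_mem (SOplus_mul_mem (hKsub hk₁) (hAsub hb)) fun x hx => ⟨?_, ?_, ?_⟩
  · refine ⟨k₂⁻¹ * c⁻¹ * x, ⟨SOplus_mul_mem (SOplus_mul_mem (hKsub (hKinv _ hk₂))
      (hAsub (hAinv _ hc))) hx.1, ?_⟩, ?_⟩
    · exact (mnorm_mul_mul_le (hC _ (hKinv _ hk₂)) hcinv hx.2).trans hbound.le
    · simp only [mul_assoc]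
      rw [Matrix.mul_nonsing_inv_cancel_left _ _ hu₂, Matrix.mul_nonsing_inv_cancel_left _ _ huc]
  · exact SOplus_mul_mem (SOplus_mul_mem (hKsub hk₁) (hAsub hb)) hx.1
  · exact (mnorm_mul_mul_le (hC _ hk₁) (hbn.le.trans hroot) hx.2).trans hbound.le
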